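/- For every positive integer N, all nonnegative integers j, m and every positive integer l: p(N, j+1, m, l) ≤ p(N, j, m, l) and p(N, j, m+1, l) ≤ p(N, j, m, l). Equivalently, b(N,j+1,m,l)·b(N,j,m,∞) ≤ b(N,j,m,l)·b(N,j+1,m,∞) and b(N,j,m+1,l)·b(N,j,m,∞) ≤ b(N,j,m,l)·b(N,j,m+1,∞). -/

import Mathlib

open scoped Classical

noncomputable section

/-- Semistandard Young tableaux of shape `μ` with entries in `{1, …, N}`. -/
def SSYTN (N : ℕ) (μ : YoungDiagram) : Type :=
  {T : SemistandardYoungTableau μ // ∀ i j : ℕ, (i, j) ∈ μ → T i j ∈ Finset.Icc 1 N}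

/-- `d_λ(N)`: the number of semistandard Young tableaux of shape `μ`
with entries in `{1, …, N}`. -/
def dCount (N : ℕ) (μ : YoungDiagram) : ℕ := Nat.card (SSYTN N μ)

/-- `f(λ')`: the number of odd columns of `μ`. -/
def oddCols (μ : YoungDiagram) : ℕ :=
  ((Finset.range μ.card).filter fun j => Odd (μ.colLen j)).card

/-- `ℓ(λ)`: the number of rows of `μ` (the length of its first column). -/
def numRows (μ : YoungDiagram) : ℕ := μ.colLen 0

/-- `b(N, j, m, l)`: the number of semistandard Young tableaux of size `2j+m`
with exactly `m` odd columns, at most `l` rows, and entries from `{1, …, N}`. -/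
def bL (N j m l : ℕ) : ℕ :=
  Nat.card (Σ μ : {μ : YoungDiagram //
    μ.card = 2 * j + m ∧ oddCols μ = m ∧ numRows μ ≤ l}, SSYTN N μ.1)

/-- `b(N, j, m, ∞)`: the number of semistandard Young tableaux of size `2j+m`
with exactly `m` odd columns and entries from `{1, …, N}`. -/
def bInf (N j m : ℕ) : ℕ :=
  Nat.card (Σ μ : {μ : YoungDiagram // μ.card = 2 * j + m ∧ oddCols μ = m}, SSYTN N μ.1)

/-- `p(N,j,m,l) = b(N,j,m,l) / b(N,j,m,∞)`. -/
def pRatio (N j m l : ℕ) : ℝ := (bL N j m l : ℝ) / (bInf N j m : ℝ)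

open Finset Polynomial in
/-- Sum of residues of `Q / P`, where `P = ∏ (X - x i)` and `Q` is monic of the same degree. -/
theorem sum_eval_div_prod_sub {ι : Type*} [DecidableEq ι] (s : Finset ι) (x : ι → ℝ) (hx : Set.InjOn x s)
    (Q : ℝ[X]) (hQ : Q.Monic) (hd : Q.natDegree = s.card) (hs : 0 < s.card) :
    ∑ i ∈ s, Q.eval (x i) / ∏ k ∈ s.erase i, (x i - x k) = Q.nextCoeff + ∑ i ∈ s, x i := by
  have hP : (Lagrange.nodal s x).Monic := Lagrange.nodal_monic
  have hPd : (Lagrange.nodal s x).natDegree = s.card := Lagrange.natDegree_nodal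
  have hlt : (Q - Lagrange.nodal s x).degree < s.card := by
    rw [← hd, ← Polynomial.degree_eq_natDegree hQ.ne_zero]
    refine Polynomial.degree_sub_lt_left ?_ hQ.ne_zero ?_
    · rw [Polynomial.degree_eq_natDegree hQ.ne_zero, Polynomial.degree_eq_natDegree hP.ne_zero,
        hd, hPd]
    · rw [hQ.leadingCoeff, hP.leadingCoeff]
  have key := Lagrange.coeff_eq_sum hx hlt
  rw [Polynomial.coeff_sub] at key
  have h1 : Q.coeff (s.card - 1) = Q.nextCoeff := by
    rw [Polynomial.nextCoeff_of_natDegree_pos (by omega), hd]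
  have h2 : (Lagrange.nodal s x).coeff (s.card - 1) = - ∑ i ∈ s, x i := by
    rw [Lagrange.nodal_eq, Polynomial.prod_X_sub_C_coeff_card_pred s x hs]
  rw [h1, h2, sub_neg_eq_add] at key
  rw [key]
  refine Finset.sum_congr rfl fun i hi => ?_
  rw [Polynomial.eval_sub, Lagrange.eval_nodal_at_node hi, sub_zero]

open Finset Polynomial in
theorem sum_prod_sub_div_prod_sub {ι κ : Type*} [DecidableEq ι] (s : Finset ι) (x : ι → ℝ) (hx : Set.InjOn x s)
    (t : Finset κ) (w : κ → ℝ) (hst : t.card = s.card) :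
    ∑ i ∈ s, (∏ k ∈ t, (x i - w k)) / ∏ k ∈ s.erase i, (x i - x k)
      = ∑ i ∈ s, x i - ∑ k ∈ t, w k := by
  rcases Nat.eq_zero_or_pos s.card with h0 | hs
  · rw [h0] at hst
    rw [Finset.card_eq_zero] at h0 hst
    simp [h0, hst]
  have := sum_eval_div_prod_sub s x hx (∏ k ∈ t, (X - C (w k))) (monic_prod_X_sub_C w t)
    (by rw [natDegree_finsetProd_X_sub_C_eq_card, hst]) hs
  rw [prod_X_sub_C_nextCoeff] at this
  simp only [eval_prod, eval_sub, eval_X, eval_C] at this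
  rw [this]; ring

open Finset Polynomial in
theorem sum_add_mul_prod_sub_div_prod_sub {ι κ : Type*} [DecidableEq ι] (s : Finset ι) (x : ι → ℝ)
    (hx : Set.InjOn x s) (t : Finset κ) (w : κ → ℝ) (c : ℝ) (hst : t.card + 1 = s.card) :
    ∑ i ∈ s, (x i + c) * (∏ k ∈ t, (x i - w k)) / ∏ k ∈ s.erase i, (x i - x k)
      = ∑ i ∈ s, x i - ∑ k ∈ t, w k + c := by
  have h := sum_prod_sub_div_prod_sub s x hx (Finset.insertNone t)
    (fun o => o.elim (-c) w) (by simp [hst])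
  simpa [sub_neg_eq_add, sub_add, add_comm, add_left_comm, sub_eq_add_neg, Finset.prod_insertNone,
    Finset.sum_insertNone] using h

open Finset in
theorem sum_add_mul_prod_one_add_div {ι : Type*} [DecidableEq ι] (s : Finset ι) (y : ι → ℝ) (hy : Set.InjOn y s)
    (c t : ℝ) :
    ∑ b ∈ s, (y b + c) * (∏ k ∈ s.erase b, (y b - y k + t)) / ∏ k ∈ s.erase b, (y b - y k)
      = ∑ b ∈ s, y b + c * s.card + t * (s.card * (s.card - 1) / 2) := by
  induction s using Finset.induction_on with
  | empty => simp
  | insert a s ha ih =>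
    have hys : Set.InjOn y s := hy.mono (by simp)
    have hne : ∀ i ∈ s, y i - y a ≠ 0 := fun i hi h => by
      have := hy (by simp [hi]) (by simp) (sub_eq_zero.mp h)
      exact ha (this ▸ hi)
    have h1 := sum_add_mul_prod_sub_div_prod_sub (insert a s) y hy s (fun k => y k - t) c
      (by rw [Finset.card_insert_of_notMem ha])
    have ih' := ih hys
    rw [Finset.sum_insert ha, Finset.erase_insert ha] at h1 ⊢
    have hE : ∀ i ∈ s, (insert a s).erase i = insert a (s.erase i) := fun i hi =>
      Finset.erase_insert_of_ne (fun h => ha (h ▸ hi))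
    have ha' : ∀ i, a ∉ s.erase i := fun i h => ha (Finset.mem_of_mem_erase h)
    have h2 : ∑ x ∈ s, (y x + c) * (∏ k ∈ (insert a s).erase x, (y x - y k + t)) /
          ∏ k ∈ (insert a s).erase x, (y x - y k)
        = ∑ b ∈ s, (y b + c) * (∏ k ∈ s.erase b, (y b - y k + t)) / (∏ k ∈ s.erase b, (y b - y k))
        + ∑ i ∈ s, (y i + c) * (∏ k ∈ s, (y i - (y k - t))) /
          ∏ k ∈ (insert a s).erase i, (y i - y k) := by
      rw [← Finset.sum_add_distrib]
      refine Finset.sum_congr rfl fun i hi => ?_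
      have hp : ∏ k ∈ s.erase i, (y i - y k) ≠ 0 := by
        refine Finset.prod_ne_zero_iff.mpr fun k hk h => ?_
        have := hys (by simpa using hi) (by simpa using Finset.mem_of_mem_erase hk)
          (sub_eq_zero.mp h)
        exact (Finset.ne_of_mem_erase hk) this.symm
      rw [hE i hi, Finset.prod_insert (ha' i), Finset.prod_insert (ha' i),
        ← Finset.mul_prod_erase s (fun k => y i - (y k - t)) hi]
      have e : ∏ k ∈ s.erase i, (y i - (y k - t)) = ∏ k ∈ s.erase i, (y i - y k + t) :=
        Finset.prod_congr rfl fun k _ => by ring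
      rw [e]
      have := hne i hi
      field_simp
      ring
    have h3 : ∏ k ∈ s, (y a - (y k - t)) = ∏ k ∈ s, (y a - y k + t) :=
        Finset.prod_congr rfl fun k _ => by ring
    rw [h3] at h1
    rw [h2, ih', Finset.sum_insert ha, Finset.card_insert_of_notMem ha]
    rw [Finset.sum_insert ha, Finset.sum_sub_distrib] at h1
    simp only [Finset.sum_const, nsmul_eq_mul] at h1
    push_cast
    linear_combination h1

open Finset Polynomial in
theorem lagrange_eval {ι : Type*} [DecidableEq ι] (s : Finset ι) (x : ι → ℝ) (hx : Set.InjOn x s)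
    (p : ℝ[X]) (hp : p.degree < s.card) (z : ℝ) :
    ∑ i ∈ s, p.eval (x i) * (∏ k ∈ s.erase i, (z - x k)) / ∏ k ∈ s.erase i, (x i - x k)
      = p.eval z := by
  conv_rhs => rw [Lagrange.eq_interpolate hx hp, Lagrange.interpolate_apply, eval_finsetSum]
  refine Finset.sum_congr rfl fun i hi => ?_
  rw [eval_mul, eval_C, Lagrange.basis, eval_prod, mul_div_assoc, ← Finset.prod_div_distrib]
  congr 1
  refine Finset.prod_congr rfl fun k hk => ?_
  rw [Lagrange.basisDivisor, eval_mul, eval_C, eval_sub, eval_X, eval_C]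
  field_simp

open Finset Polynomial in
theorem sum_sum_cross_ratio {ι κ : Type*} [DecidableEq ι] [DecidableEq κ] (s : Finset ι) (t : Finset κ) (x : ι → ℝ) (y : κ → ℝ)
    (hx : Set.InjOn x s) (e : ℝ) (g : κ → ℝ) (f : ℝ[X])
    (hf : f.natDegree + t.card ≤ s.card) :
    ∑ b ∈ t, ∑ a ∈ s, g b * f.eval (x a) *
        ((∏ k ∈ t.erase b, (x a + e - y k)) * ∏ k ∈ s.erase a, (y b + e - x k)) /
        ((∏ k ∈ s.erase a, (x a - x k)) * ∏ k ∈ t.erase b, (y b - y k))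
      = ∑ b ∈ t, g b * f.eval (y b + e) * (∏ k ∈ t.erase b, (y b - y k + 2 * e)) /
          ∏ k ∈ t.erase b, (y b - y k) := by
  refine Finset.sum_congr rfl fun b hb => ?_
  have hcard : (t.erase b).card + 1 = t.card := Finset.card_erase_add_one hb
  have hdeg : (f * ∏ k ∈ t.erase b, (X - C (y k - e))).degree < s.card := by
    refine lt_of_le_of_lt (Polynomial.degree_le_natDegree) ?_
    have h1 := Polynomial.natDegree_mul_le (p := f) (q := ∏ k ∈ t.erase b, (X - C (y k - e)))
    rw [natDegree_finsetProd_X_sub_C_eq_card] at h1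
    exact_mod_cast (by omega)
  have := lagrange_eval s x hx _ hdeg (y b + e)
  simp only [eval_mul, eval_prod, eval_sub, eval_X, eval_C] at this
  have e1 : ∏ k ∈ t.erase b, (y b + e - (y k - e)) = ∏ k ∈ t.erase b, (y b - y k + 2 * e) :=
    Finset.prod_congr rfl fun k _ => by ring
  rw [e1] at this
  rw [mul_assoc (g b), mul_div_assoc (g b), mul_div_assoc, ← mul_div_assoc, ← this,
    Finset.sum_div, Finset.mul_sum]
  refine Finset.sum_congr rfl fun a _ => ?_
  have e2 : ∏ k ∈ t.erase b, (x a - (y k - e)) = ∏ k ∈ t.erase b, (x a + e - y k) :=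
    Finset.prod_congr rfl fun k _ => by ring
  rw [e2, mul_div_assoc (g b * _), mul_div_mul_comm]
  ring

/-- Weight of the transition adding (`e = c = 1`) or removing (`e = -1`, `c = 0`) one box in the
row of even index `2 * a`; here `x` and `y` are the shifted row lengths of even and odd index. -/
def boxWeight (N : ℕ) (e c : ℝ) (x y : ℕ → ℝ) (a : ℕ) : ℝ :=
  (if Even N then 1 else x a + c) * (∏ b ∈ Finset.range (N / 2), (x a + e - y b)) /
    ∏ k ∈ (Finset.range ((N + 1) / 2)).erase a, (x a - x k)

/-- Weight of the transition adding (`e = c = 1`) or removing (`e = -1`, `c = 0`) one box in each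
of the rows of index `2 * a` and `2 * b + 1`. -/
def pairWeight (N : ℕ) (e c : ℝ) (x y : ℕ → ℝ) (a b : ℕ) : ℝ :=
  (if Even N then y b + c else x a + c) *
    ((∏ k ∈ (Finset.range (N / 2)).erase b, (x a + e - y k)) *
      ∏ k ∈ (Finset.range ((N + 1) / 2)).erase a, (y b + e - x k)) /
    ((∏ k ∈ (Finset.range ((N + 1) / 2)).erase a, (x a - x k)) *
      ∏ k ∈ (Finset.range (N / 2)).erase b, (y b - y k))

theorem sum_boxWeight (N : ℕ) (e c : ℝ) (x y : ℕ → ℝ)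
    (hx : Set.InjOn x (Finset.range ((N + 1) / 2))) :
    ∑ a ∈ Finset.range ((N + 1) / 2), boxWeight N e c x y a
      = ∑ a ∈ Finset.range ((N + 1) / 2), x a - ∑ b ∈ Finset.range (N / 2), y b
        + e * (N / 2 : ℕ) + if Even N then 0 else c := by
  have e1 : ∀ a, ∏ b ∈ Finset.range (N / 2), (x a + e - y b)
      = ∏ b ∈ Finset.range (N / 2), (x a - (y b - e)) := fun a =>
    Finset.prod_congr rfl fun k _ => by ring
  unfold boxWeight
  simp only [e1]
  by_cases h : Even N
  · have := sum_prod_sub_div_prod_sub _ x hx (Finset.range (N / 2)) (fun b => y b - e)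
      (by simp only [Finset.card_range]; obtain ⟨q, rfl⟩ := h; omega)
    simp only [h, if_true, one_mul]
    rw [this, Finset.sum_sub_distrib]
    simp
    ring
  · have := sum_add_mul_prod_sub_div_prod_sub _ x hx (Finset.range (N / 2)) (fun b => y b - e) c
      (by simp only [Finset.card_range]; rw [Nat.not_even_iff_odd] at h; obtain ⟨q, rfl⟩ := h; omega)
    simp only [h, if_false]
    rw [this, Finset.sum_sub_distrib]
    simp
    ring

open Polynomial in
theorem sum_pairWeight (N : ℕ) (e c : ℝ) (x y : ℕ → ℝ)
    (hx : Set.InjOn x (Finset.range ((N + 1) / 2))) (hy : Set.InjOn y (Finset.range (N / 2))) :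
    ∑ b ∈ Finset.range (N / 2), ∑ a ∈ Finset.range ((N + 1) / 2), pairWeight N e c x y a b
      = ∑ b ∈ Finset.range (N / 2), y b + (if Even N then c else c + e) * (N / 2 : ℕ)
        + e * ((N / 2 : ℕ) * ((N / 2 : ℕ) - 1)) := by
  unfold pairWeight
  by_cases h : Even N
  · have h1 := sum_sum_cross_ratio _ (Finset.range (N / 2)) x y hx e (fun b => y b + c) 1
      (by simp; omega)
    have h2 := sum_add_mul_prod_one_add_div _ y hy c (2 * e)
    simp only [eval_one, mul_one] at h1
    simp only [h, if_true]
    rw [h1, h2]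
    simp
    ring
  · have h1 := sum_sum_cross_ratio _ (Finset.range (N / 2)) x y hx e (fun b => 1) (X + C c)
      (by simp; rw [Nat.not_even_iff_odd] at h; obtain ⟨q, rfl⟩ := h; omega)
    have h2 := sum_add_mul_prod_one_add_div _ y hy (c + e) (2 * e)
    simp only [eval_add, eval_X, eval_C, one_mul] at h1
    have e1 : ∀ b, y b + e + c = y b + (c + e) := fun b => by ring
    simp only [e1] at h1
    simp only [h, if_false]
    rw [h1, h2]
    simp
    ring

/-- A product whose factors with index below `t` are nonpositive and whose other factors are
nonnegative has the sign given by the number of the former. -/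
theorem neg_one_pow_mul_prod_nonneg (s : Finset ℕ) (f : ℕ → ℝ) (t : ℕ)
    (h1 : ∀ k ∈ s, k < t → f k ≤ 0) (h2 : ∀ k ∈ s, t ≤ k → 0 ≤ f k) :
    0 ≤ (-1) ^ (s.filter (· < t)).card * ∏ k ∈ s, f k := by
  rw [← Finset.prod_filter_mul_prod_filter_not s (· < t), ← mul_assoc, ← Finset.prod_const,
    ← Finset.prod_mul_distrib]
  refine mul_nonneg (Finset.prod_nonneg fun k hk => ?_) (Finset.prod_nonneg fun k hk => ?_)
  · rw [Finset.mem_filter] at hk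
    linarith [h1 k hk.1 hk.2]
  · rw [Finset.mem_filter] at hk
    exact h2 k hk.1 (not_lt.mp hk.2)

theorem card_filter_lt_range (n t : ℕ) (h : t ≤ n) :
    ((Finset.range n).filter (· < t)).card = t := by
  have : (Finset.range n).filter (· < t) = Finset.range t := by
    ext k; simp; omega
  rw [this, Finset.card_range]

theorem card_filter_lt_range_erase (n t a : ℕ) (h : t ≤ n) :
    (((Finset.range n).erase a).filter (· < t)).card + (if a < t then 1 else 0) = t := by
  rw [Finset.filter_erase]
  split_ifs with hat
  · rw [Finset.card_erase_add_one (by simp; omega), card_filter_lt_range n t h]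
  · rw [Finset.erase_eq_of_notMem (by simp; omega), card_filter_lt_range n t h, add_zero]

theorem boxWeight_nonneg (N : ℕ) (x y : ℕ → ℝ) (a : ℕ) (ha : a < (N + 1) / 2)
    (hpos : 0 ≤ x a)
    (hxx : ∀ i k, i < k → k < (N + 1) / 2 → x k ≤ x i)
    (hxy : ∀ i k, i ≤ k → k < N / 2 → y k ≤ x i + 1)
    (hyx : ∀ i k, i < k → k < (N + 1) / 2 → x k + 1 ≤ y i) :
    0 ≤ boxWeight N 1 1 x y a := by
  have h1 := neg_one_pow_mul_prod_nonneg (Finset.range (N / 2)) (fun b => x a + 1 - y b) a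
    (fun k hk hka => by linarith [hyx k a hka ha])
    (fun k hk hka => by linarith [hxy a k hka (by simpa using hk)])
  have h2 := neg_one_pow_mul_prod_nonneg ((Finset.range ((N + 1) / 2)).erase a)
    (fun k => x a - x k) a
    (fun k hk hka => by linarith [hxx k a hka ha])
    (fun k hk hka => by
      simp at hk
      linarith [hxx a k (by omega) (by omega)])
  rw [card_filter_lt_range _ _ (by omega)] at h1
  have hc := card_filter_lt_range_erase ((N + 1) / 2) a a (by omega)
  simp only [lt_irrefl, if_false, add_zero] at hc
  rw [hc] at h2
  unfold boxWeight
  rw [mul_div_assoc]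
  refine mul_nonneg (by split_ifs <;> linarith) ?_
  rcases neg_one_pow_eq_or ℝ a with h | h
  · rw [h] at h1 h2
    exact div_nonneg (by linarith) (by linarith)
  · rw [h] at h1 h2
    exact div_nonneg_of_nonpos (by linarith) (by linarith)

theorem div_nonneg_of_neg_one_pow {p q r s : ℕ} {A B C D : ℝ} (hA : 0 ≤ (-1) ^ p * A)
    (hB : 0 ≤ (-1) ^ q * B) (hC : 0 ≤ (-1) ^ r * C) (hD : 0 ≤ (-1) ^ s * D)
    (h : Even (p + q + r + s)) : 0 ≤ A * B / (C * D) := by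
  have h1 : 0 ≤ ((-1) ^ p * A) * ((-1) ^ q * B) / (((-1) ^ r * C) * ((-1) ^ s * D)) := by positivity
  have h2 : ((-1 : ℝ)) ^ p * (-1) ^ q * ((-1) ^ r * (-1) ^ s) = 1 := by
    rw [← pow_add, ← pow_add, ← pow_add, ← add_assoc, h.neg_one_pow]
  have h3 : ((-1 : ℝ) ^ r * (-1) ^ s) * ((-1) ^ r * (-1) ^ s) = 1 := by
    rw [← pow_add, ← pow_add, Even.neg_one_pow ⟨_, rfl⟩]
  have h4 : ((-1 : ℝ)) ^ p * (-1) ^ q = (-1) ^ r * (-1) ^ s := by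
    linear_combination ((-1 : ℝ) ^ r * (-1) ^ s) * h2 - ((-1 : ℝ)) ^ p * (-1) ^ q * h3
  have h5 : ((-1 : ℝ) ^ r * (-1) ^ s) ≠ 0 := by simp
  have h6 : ((-1) ^ p * A) * ((-1) ^ q * B) / (((-1) ^ r * C) * ((-1) ^ s * D)) = A * B / (C * D) := by
    rw [show ((-1 : ℝ)) ^ p * A * ((-1) ^ q * B) = ((-1) ^ r * (-1) ^ s) * (A * B) by
      rw [← h4]; ring]
    rw [show ((-1 : ℝ)) ^ r * C * ((-1) ^ s * D) = ((-1) ^ r * (-1) ^ s) * (C * D) by ring]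
    exact mul_div_mul_left _ _ h5
  rwa [h6] at h1

theorem pairWeight_nonneg (N : ℕ) (x y : ℕ → ℝ) (a b : ℕ) (ha : a < (N + 1) / 2)
    (hb : b < N / 2) (hpos : 0 ≤ x a) (hpos' : 0 ≤ y b)
    (hxx : ∀ i k, i < k → k < (N + 1) / 2 → x k ≤ x i)
    (hyy : ∀ i k, i < k → k < N / 2 → y k ≤ y i)
    (hxy : ∀ i k, i ≤ k → k < N / 2 → y k + 1 ≤ x i)
    (hyx : ∀ i k, i < k → k < (N + 1) / 2 → x k + 1 ≤ y i) :
    0 ≤ pairWeight N 1 1 x y a b := by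
  have h1 := neg_one_pow_mul_prod_nonneg ((Finset.range (N / 2)).erase b)
    (fun k => x a + 1 - y k) a
    (fun k hk hka => by linarith [hyx k a hka ha])
    (fun k hk hka => by
      simp at hk
      linarith [hxy a k hka (by omega)])
  have h2 := neg_one_pow_mul_prod_nonneg ((Finset.range ((N + 1) / 2)).erase a)
    (fun k => y b + 1 - x k) (b + 1)
    (fun k hk hka => by linarith [hxy k b (by omega) hb])
    (fun k hk hka => by
      simp at hk
      linarith [hyx b k (by omega) (by omega)])
  have h3 := neg_one_pow_mul_prod_nonneg ((Finset.range ((N + 1) / 2)).erase a)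
    (fun k => x a - x k) a
    (fun k hk hka => by linarith [hxx k a hka ha])
    (fun k hk hka => by
      simp at hk
      linarith [hxx a k (by omega) (by omega)])
  have h4 := neg_one_pow_mul_prod_nonneg ((Finset.range (N / 2)).erase b)
    (fun k => y b - y k) b
    (fun k hk hka => by linarith [hyy k b hka hb])
    (fun k hk hka => by
      simp at hk
      linarith [hyy b k (by omega) (by omega)])
  have c1 := card_filter_lt_range_erase (N / 2) a b (by omega)
  have c2 := card_filter_lt_range_erase ((N + 1) / 2) (b + 1) a (by omega)
  have c3 := card_filter_lt_range_erase ((N + 1) / 2) a a (by omega)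
  have c4 := card_filter_lt_range_erase (N / 2) b b (by omega)
  unfold pairWeight
  rw [mul_div_assoc]
  refine mul_nonneg (by split_ifs <;> linarith) ?_
  refine div_nonneg_of_neg_one_pow h1 h2 h3 h4 ?_
  rw [Nat.even_iff]
  split_ifs at c1 c2 c3 c4 <;> omega

theorem prod_range_eq_prod_even_mul_prod_odd (N : ℕ) (F : ℕ → ℝ) :
    ∏ i ∈ Finset.range N, F i = (∏ a ∈ Finset.range ((N + 1) / 2), F (2 * a)) *
      ∏ b ∈ Finset.range (N / 2), F (2 * b + 1) := by
  induction N with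
  | zero => simp
  | succ N ih =>
    rw [Finset.prod_range_succ, ih]
    rcases Nat.even_or_odd' N with ⟨q, rfl | rfl⟩
    · rw [show (2 * q + 1) / 2 = q by omega, show (2 * q + 1 + 1) / 2 = q + 1 by omega,
        show 2 * q / 2 = q by omega, Finset.prod_range_succ _ q]
      ring
    · rw [show (2 * q + 1 + 1 + 1) / 2 = q + 1 by omega, show (2 * q + 1 + 1) / 2 = q + 1 by omega,
        show (2 * q + 1) / 2 = q by omega, Finset.prod_range_succ (fun b => F (2 * b + 1)) q]
      ring

theorem sum_range_eq_sum_even_add_sum_odd {M : Type*} [AddCommMonoid M] (N : ℕ) (F : ℕ → M) :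
    ∑ i ∈ Finset.range N, F i = (∑ a ∈ Finset.range ((N + 1) / 2), F (2 * a)) +
      ∑ b ∈ Finset.range (N / 2), F (2 * b + 1) := by
  induction N with
  | zero => simp
  | succ N ih =>
    rw [Finset.sum_range_succ, ih]
    rcases Nat.even_or_odd' N with ⟨q, rfl | rfl⟩
    · rw [show (2 * q + 1) / 2 = q by omega, show (2 * q + 1 + 1) / 2 = q + 1 by omega,
        show 2 * q / 2 = q by omega, Finset.sum_range_succ _ q]
      abel
    · rw [show (2 * q + 1 + 1 + 1) / 2 = q + 1 by omega, show (2 * q + 1 + 1) / 2 = q + 1 by omega,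
        show (2 * q + 1) / 2 = q by omega, Finset.sum_range_succ (fun b => F (2 * b + 1)) q]
      abel

theorem prod_erase_eq_prod_ite {s : Finset ℕ} (i : ℕ) (F : ℕ → ℝ) :
    ∏ k ∈ s.erase i, F k = ∏ k ∈ s, if k = i then 1 else F k := by
  rw [← Finset.prod_erase s (a := i) (by simp)]
  refine Finset.prod_congr rfl fun k hk => ?_
  rw [if_neg (Finset.ne_of_mem_erase hk)]

theorem prod_range_erase_even (N a : ℕ) (F : ℕ → ℝ) :
    ∏ i ∈ (Finset.range N).erase (2 * a), F i
      = (∏ k ∈ (Finset.range ((N + 1) / 2)).erase a, F (2 * k)) *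
        ∏ b ∈ Finset.range (N / 2), F (2 * b + 1) := by
  rw [prod_erase_eq_prod_ite, prod_range_eq_prod_even_mul_prod_odd,
    prod_erase_eq_prod_ite (s := Finset.range ((N + 1) / 2))]
  congr 1
  · refine Finset.prod_congr rfl fun k _ => ?_
    simp
  · refine Finset.prod_congr rfl fun k _ => ?_
    rw [if_neg (by omega)]

theorem prod_range_erase_even_erase_odd (N a b : ℕ) (F : ℕ → ℝ) :
    ∏ i ∈ ((Finset.range N).erase (2 * a)).erase (2 * b + 1), F i
      = (∏ k ∈ (Finset.range ((N + 1) / 2)).erase a, F (2 * k)) *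
        ∏ k ∈ (Finset.range (N / 2)).erase b, F (2 * k + 1) := by
  rw [prod_erase_eq_prod_ite, prod_range_erase_even,
    prod_erase_eq_prod_ite (s := Finset.range (N / 2))]
  congr 1
  · refine Finset.prod_congr rfl fun k _ => ?_
    rw [if_neg (by omega)]
  · refine Finset.prod_congr rfl fun k _ => ?_
    simp

/-- The Vandermonde determinant of the first `N` values of `L`. -/
def vdet (N : ℕ) (L : ℕ → ℝ) : ℝ := (Matrix.vandermonde fun i : Fin N => L i).det

theorem vdet_eq_prod (N : ℕ) (L : ℕ → ℝ) :
    vdet N L = ∏ i ∈ Finset.range N, ∏ j ∈ Finset.range N, if i < j then L j - L i else 1 := by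
  unfold vdet
  rw [Matrix.det_vandermonde, ← Fin.prod_univ_eq_prod_range
    (fun i => ∏ j ∈ Finset.range N, if i < j then L j - L i else 1)]
  refine Finset.prod_congr rfl fun i _ => ?_
  rw [← Fin.prod_univ_eq_prod_range (fun j => if (i : ℕ) < j then L j - L i else 1),
    ← Finset.prod_filter]
  refine Finset.prod_congr ?_ fun _ _ => rfl
  ext j
  simp

theorem exists_vdet_update_eq (N : ℕ) (L : ℕ → ℝ) (i : ℕ) (hi : i < N) :
    ∃ C : ℝ, ∀ z, vdet N (Function.update L i z)
      = C * ∏ k ∈ (Finset.range N).erase i, (z - L k) := by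
  have hi' : i ∈ Finset.range N := Finset.mem_range.mpr hi
  refine ⟨(∏ a ∈ (Finset.range N).erase i, ∏ b ∈ (Finset.range N).erase i,
    if a < b then L b - L a else 1) * ∏ k ∈ (Finset.range N).erase i, (if i < k then -1 else 1),
    fun z => ?_⟩
  rw [vdet_eq_prod, ← Finset.mul_prod_erase _ _ hi', ← Finset.mul_prod_erase _ _ hi']
  have h1 : ∀ a ∈ (Finset.range N).erase i, (∏ b ∈ Finset.range N, if a < b then
      Function.update L i z b - Function.update L i z a else 1)
      = (if a < i then z - L a else 1) *
        ∏ b ∈ (Finset.range N).erase i, if a < b then L b - L a else 1 := by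
    intro a ha
    rw [← Finset.mul_prod_erase _ _ hi']
    congr 1
    · simp [Function.update_of_ne (Finset.ne_of_mem_erase ha)]
    · refine Finset.prod_congr rfl fun b hb => ?_
      rw [Function.update_of_ne (Finset.ne_of_mem_erase ha),
        Function.update_of_ne (Finset.ne_of_mem_erase hb)]
  rw [Finset.prod_congr rfl h1, Finset.prod_mul_distrib]
  have h2 : (∏ b ∈ (Finset.range N).erase i, if i < b then
      Function.update L i z b - Function.update L i z i else 1)
      = ∏ b ∈ (Finset.range N).erase i, if i < b then L b - z else 1 := by
    refine Finset.prod_congr rfl fun b hb => ?_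
    rw [Function.update_of_ne (Finset.ne_of_mem_erase hb), Function.update_self]
  have h3 : (∏ b ∈ (Finset.range N).erase i, if i < b then L b - z else 1) *
      (∏ a ∈ (Finset.range N).erase i, if a < i then z - L a else 1)
      = (∏ k ∈ (Finset.range N).erase i, (if i < k then -1 else 1)) *
        ∏ k ∈ (Finset.range N).erase i, (z - L k) := by
    rw [← Finset.prod_mul_distrib, ← Finset.prod_mul_distrib]
    refine Finset.prod_congr rfl fun b hb => ?_
    have hne := Finset.ne_of_mem_erase hb
    rcases lt_or_gt_of_ne hne with h | h
    · simp [h, h.not_gt]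
    · simp [h, h.not_gt]
  rw [h2]
  simp only [lt_irrefl, if_false, one_mul]
  linear_combination (∏ a ∈ (Finset.range N).erase i, ∏ b ∈ (Finset.range N).erase i,
    if a < b then L b - L a else 1) * h3

theorem vdet_update_mul (N : ℕ) (L : ℕ → ℝ) (i : ℕ) (hi : i < N) (z : ℝ) :
    vdet N (Function.update L i z) * ∏ k ∈ (Finset.range N).erase i, (L i - L k)
      = vdet N L * ∏ k ∈ (Finset.range N).erase i, (z - L k) := by
  obtain ⟨C, hC⟩ := exists_vdet_update_eq N L i hi
  have h := hC (L i)
  rw [Function.update_eq_self] at h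
  rw [hC, h]
  ring

theorem vdet_update_update_mul (N : ℕ) (L : ℕ → ℝ) (i k : ℕ) (hi : i < N) (hk : k < N)
    (hik : i ≠ k) (z w : ℝ) (h : z ≠ L k ∨ w ≠ L i) :
    vdet N (Function.update (Function.update L i z) k w) * ((L i - L k) *
      ∏ m ∈ ((Finset.range N).erase i).erase k, ((L i - L m) * (L k - L m)))
      = vdet N L * ((z - w) *
        ∏ m ∈ ((Finset.range N).erase i).erase k, ((z - L m) * (w - L m))) := by
  have main : ∀ (i k : ℕ) (_ : i < N) (_ : k < N) (_ : i ≠ k) (z w : ℝ) (_ : z ≠ L k),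
      vdet N (Function.update (Function.update L i z) k w) * ((L i - L k) *
      ∏ m ∈ ((Finset.range N).erase i).erase k, ((L i - L m) * (L k - L m)))
      = vdet N L * ((z - w) *
        ∏ m ∈ ((Finset.range N).erase i).erase k, ((z - L m) * (w - L m))) := by
    intro i k hi hk hik z w hz
    have h1 := vdet_update_mul N L i hi z
    have h2 := vdet_update_mul N (Function.update L i z) k hk w
    have hk' : k ∈ (Finset.range N).erase i := by simp [hk, hik.symm]
    have hi' : i ∈ (Finset.range N).erase k := by simp [hi, hik]
    rw [← Finset.mul_prod_erase _ _ hk', ← Finset.mul_prod_erase _ _ hk'] at h1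
    rw [← Finset.mul_prod_erase _ _ hi', ← Finset.mul_prod_erase _ _ hi',
      Finset.erase_right_comm] at h2
    have e : ∀ u : ℝ, ∏ m ∈ ((Finset.range N).erase i).erase k, (u - Function.update L i z m)
        = ∏ m ∈ ((Finset.range N).erase i).erase k, (u - L m) := fun u =>
      Finset.prod_congr rfl fun m hm => by
        rw [Function.update_of_ne (Finset.ne_of_mem_erase (Finset.mem_of_mem_erase hm))]
    rw [e, e, Function.update_self, Function.update_of_ne hik.symm] at h2
    rw [Finset.prod_mul_distrib, Finset.prod_mul_distrib]
    have hz' : z - L k ≠ 0 := sub_ne_zero.mpr hz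
    apply mul_left_cancel₀ hz'
    linear_combination (-(L i - L k) * ∏ m ∈ ((Finset.range N).erase i).erase k, (L i - L m)) * h2
      - (w - z) * (∏ m ∈ ((Finset.range N).erase i).erase k, (w - L m)) * h1
  rcases h with h | h
  · exact main i k hi hk hik z w h
  · have := main k i hk hi hik.symm w z h
    rw [Function.update_comm hik.symm, Finset.erase_right_comm] at this
    simp only [mul_comm (L k - L _) (L i - L _), mul_comm (w - L _) (z - L _)] at this
    linear_combination -this

theorem prod_sub_ne_zero {L : ℕ → ℝ} {s t : Finset ℕ} {i : ℕ} (hL : Set.InjOn L s) (hi : i ∈ s)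
    (ht : t ⊆ s.erase i) : ∏ k ∈ t, (L i - L k) ≠ 0 := by
  refine Finset.prod_ne_zero_iff.mpr fun k hk h => ?_
  have hk' := ht hk
  exact Finset.ne_of_mem_erase hk' (hL (by exact_mod_cast Finset.mem_of_mem_erase hk')
    (by exact_mod_cast hi) (sub_eq_zero.mp h).symm)

theorem vdet_mul_boxWeight (N : ℕ) (L : ℕ → ℝ) (a : ℕ) (ha : a < (N + 1) / 2)
    (hL : Set.InjOn L (Finset.range N))
    (hL' : Set.InjOn (Function.update L (2 * a) (L (2 * a) + 1)) (Finset.range N)) :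
    vdet N (Function.update L (2 * a) (L (2 * a) + 1)) *
      boxWeight N (-1) 0 (fun k => Function.update L (2 * a) (L (2 * a) + 1) (2 * k))
        (fun k => Function.update L (2 * a) (L (2 * a) + 1) (2 * k + 1)) a
      = vdet N L * boxWeight N 1 1 (fun k => L (2 * k)) (fun k => L (2 * k + 1)) a := by
  have haN : 2 * a < N := by omega
  have ha' : 2 * a ∈ Finset.range N := by simpa using haN
  have h := vdet_update_mul N L (2 * a) haN (L (2 * a) + 1)
  have n1 := prod_sub_ne_zero hL ha' subset_rfl
  have n2 := prod_sub_ne_zero hL' ha' subset_rfl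
  have e : ∏ k ∈ (Finset.range N).erase (2 * a),
      (Function.update L (2 * a) (L (2 * a) + 1) (2 * a) -
        Function.update L (2 * a) (L (2 * a) + 1) k)
      = ∏ k ∈ (Finset.range N).erase (2 * a), (L (2 * a) + 1 - L k) :=
    Finset.prod_congr rfl fun k hk => by
      rw [Function.update_self, Function.update_of_ne (Finset.ne_of_mem_erase hk)]
  rw [e] at n2
  rw [prod_range_erase_even] at n1 n2
  rw [prod_range_erase_even, prod_range_erase_even] at h
  unfold boxWeight
  beta_reduce
  rw [Function.update_self]
  have e1 : ∏ k ∈ (Finset.range ((N + 1) / 2)).erase a,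
      (L (2 * a) + 1 - Function.update L (2 * a) (L (2 * a) + 1) (2 * k))
      = ∏ k ∈ (Finset.range ((N + 1) / 2)).erase a, (L (2 * a) + 1 - L (2 * k)) :=
    Finset.prod_congr rfl fun k hk => by
      have := Finset.ne_of_mem_erase hk
      rw [Function.update_of_ne (by omega)]
  have e2 : ∏ b ∈ Finset.range (N / 2),
      (L (2 * a) + 1 + -1 - Function.update L (2 * a) (L (2 * a) + 1) (2 * b + 1))
      = ∏ b ∈ Finset.range (N / 2), (L (2 * a) - L (2 * b + 1)) :=
    Finset.prod_congr rfl fun k hk => by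
      rw [Function.update_of_ne (by omega)]
      ring
  rw [e1, e2, add_zero]
  have n3 := left_ne_zero_of_mul n1
  have n4 := left_ne_zero_of_mul n2
  rw [← mul_div_assoc, ← mul_div_assoc, div_eq_div_iff n4 n3]
  linear_combination (if Even N then (1 : ℝ) else L (2 * a) + 1) * h

theorem vdet_mul_pairWeight (N : ℕ) (L : ℕ → ℝ) (a b : ℕ) (ha : a < (N + 1) / 2)
    (hb : b < N / 2) (L' : ℕ → ℝ)
    (hLL' : L' = Function.update (Function.update L (2 * a) (L (2 * a) + 1)) (2 * b + 1)
      (L (2 * b + 1) + 1))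
    (hL : Set.InjOn L (Finset.range N)) (hL' : Set.InjOn L' (Finset.range N)) :
    vdet N L' * pairWeight N (-1) 0 (fun k => L' (2 * k)) (fun k => L' (2 * k + 1)) a b
      = vdet N L * pairWeight N 1 1 (fun k => L (2 * k)) (fun k => L (2 * k + 1)) a b := by
  have haN : 2 * a ∈ Finset.range N := by simp; omega
  have hbN : 2 * b + 1 ∈ Finset.range N := by simp; omega
  have hne : L (2 * a) - L (2 * b + 1) ≠ 0 := fun h => by
    have := hL (by exact_mod_cast haN) (by exact_mod_cast hbN) (sub_eq_zero.mp h)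
    omega
  have h := vdet_update_update_mul N L (2 * a) (2 * b + 1) (by omega) (by omega) (by omega)
    (L (2 * a) + 1) (L (2 * b + 1) + 1) (by
      by_contra hc
      push Not at hc
      linarith [hc.1, hc.2])
  rw [← hLL', show L (2 * a) + 1 - (L (2 * b + 1) + 1) = L (2 * a) - L (2 * b + 1) by ring] at h
  have h' := mul_left_cancel₀ hne (b := vdet N L' * ∏ m ∈ ((Finset.range N).erase (2 * a)).erase
      (2 * b + 1), ((L (2 * a) - L m) * (L (2 * b + 1) - L m)))
    (c := vdet N L * ∏ m ∈ ((Finset.range N).erase (2 * a)).erase (2 * b + 1),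
      ((L (2 * a) + 1 - L m) * (L (2 * b + 1) + 1 - L m))) (by linear_combination h)
  rw [Finset.prod_mul_distrib, Finset.prod_mul_distrib, prod_range_erase_even_erase_odd,
    prod_range_erase_even_erase_odd, prod_range_erase_even_erase_odd,
    prod_range_erase_even_erase_odd] at h'
  have l1 : L' (2 * a) = L (2 * a) + 1 := by
    rw [hLL', Function.update_of_ne (by omega), Function.update_self]
  have l2 : L' (2 * b + 1) = L (2 * b + 1) + 1 := by
    rw [hLL', Function.update_self]
  have l3 : ∀ k ∈ (Finset.range ((N + 1) / 2)).erase a, L' (2 * k) = L (2 * k) := fun k hk => by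
    have := Finset.ne_of_mem_erase hk
    rw [hLL', Function.update_of_ne (by omega), Function.update_of_ne (by omega)]
  have l4 : ∀ k ∈ (Finset.range (N / 2)).erase b, L' (2 * k + 1) = L (2 * k + 1) := fun k hk => by
    have := Finset.ne_of_mem_erase hk
    rw [hLL', Function.update_of_ne (by omega), Function.update_of_ne (by omega)]
  have nx : ∀ M : ℕ → ℝ, Set.InjOn M (Finset.range N) →
      ∏ k ∈ (Finset.range ((N + 1) / 2)).erase a, (M (2 * a) - M (2 * k)) ≠ 0 := by
    intro M hM
    have := prod_sub_ne_zero hM haN subset_rfl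
    rw [prod_range_erase_even] at this
    exact left_ne_zero_of_mul this
  have ny : ∀ M : ℕ → ℝ, Set.InjOn M (Finset.range N) →
      ∏ k ∈ (Finset.range (N / 2)).erase b, (M (2 * b + 1) - M (2 * k + 1)) ≠ 0 := by
    intro M hM
    have := prod_sub_ne_zero hM hbN (t := ((Finset.range N).erase (2 * a)).erase (2 * b + 1))
      (by rw [Finset.erase_right_comm]; exact Finset.erase_subset _ _)
    rw [prod_range_erase_even_erase_odd] at this
    exact right_ne_zero_of_mul this
  have e1 : ∏ k ∈ (Finset.range ((N + 1) / 2)).erase a, (L' (2 * a) - L' (2 * k))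
      = ∏ k ∈ (Finset.range ((N + 1) / 2)).erase a, (L (2 * a) + 1 - L (2 * k)) :=
    Finset.prod_congr rfl fun k hk => by rw [l1, l3 k hk]
  have e2 : ∏ k ∈ (Finset.range (N / 2)).erase b, (L' (2 * b + 1) - L' (2 * k + 1))
      = ∏ k ∈ (Finset.range (N / 2)).erase b, (L (2 * b + 1) + 1 - L (2 * k + 1)) :=
    Finset.prod_congr rfl fun k hk => by rw [l2, l4 k hk]
  have e3 : ∏ k ∈ (Finset.range ((N + 1) / 2)).erase a, (L' (2 * b + 1) + -1 - L' (2 * k))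
      = ∏ k ∈ (Finset.range ((N + 1) / 2)).erase a, (L (2 * b + 1) - L (2 * k)) :=
    Finset.prod_congr rfl fun k hk => by rw [l2, l3 k hk]; ring
  have e4 : ∏ k ∈ (Finset.range (N / 2)).erase b, (L' (2 * a) + -1 - L' (2 * k + 1))
      = ∏ k ∈ (Finset.range (N / 2)).erase b, (L (2 * a) - L (2 * k + 1)) :=
    Finset.prod_congr rfl fun k hk => by rw [l1, l4 k hk]; ring
  have n1 := nx L hL
  have n2 := ny L hL
  have n3 := nx L' hL'
  have n4 := ny L' hL'
  unfold pairWeight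
  beta_reduce
  rw [e1] at n3 ⊢
  rw [e2] at n4 ⊢
  rw [e3, e4, l1, l2, add_zero, add_zero]
  rw [← mul_div_assoc, ← mul_div_assoc, div_eq_div_iff (mul_ne_zero n3 n4) (mul_ne_zero n1 n2)]
  linear_combination (if Even N then L (2 * b + 1) + 1 else L (2 * a) + 1) * h'

/-- `T` is a semistandard filling, with entries in `{1, …, N}`, of the diagram with row lengths `r`,
extended by zero outside of the diagram. -/
structure IsTableau (N : ℕ) (r : ℕ → ℕ) (T : ℕ → ℕ → ℕ) : Prop where
  row_weak : ∀ {i j k}, j < k → k < r i → T i j ≤ T i k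
  col_strict : ∀ {i k j}, i < k → j < r k → T i j < T k j
  mem_Icc : ∀ {i j}, j < r i → T i j ∈ Finset.Icc 1 N
  zeros : ∀ {i j}, r i ≤ j → T i j = 0

theorem IsTableau.lt_entry {N : ℕ} {r : ℕ → ℕ} {T : ℕ → ℕ → ℕ} (hT : IsTableau N r T)
    (hr : Antitone r) {i j : ℕ} (h : j < r i) : i < T i j := by
  induction i with
  | zero => exact (Finset.mem_Icc.mp (hT.mem_Icc h)).1
  | succ i ih =>
    have h1 := ih (h.trans_le (hr i.le_succ))
    have h2 := hT.col_strict (Nat.lt_add_one i) h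
    omega

theorem IsTableau.row_eq_zero {N : ℕ} {r : ℕ → ℕ} {T : ℕ → ℕ → ℕ} (hT : IsTableau N r T)
    (hr : Antitone r) : r N = 0 := by
  by_contra h
  have h1 := hT.lt_entry hr (Nat.pos_of_ne_zero h)
  have h2 := hT.mem_Icc (Nat.pos_of_ne_zero h)
  rw [Finset.mem_Icc] at h2
  omega

/-- Extension by zero of a tuple of row lengths. -/
def extendRows {N : ℕ} (s : Fin N → ℕ) (i : ℕ) : ℕ := if h : i < N then s ⟨i, h⟩ else 0

/-- The tuples of row lengths which interlace with `r`. -/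
abbrev interlacing (N : ℕ) (r : ℕ → ℕ) : Finset (Fin N → ℕ) :=
  Fintype.piFinset fun i : Fin N => Finset.Icc (r (i + 1)) (r i)

/-- The number of entries at most `N` in the rows of a filling. -/
def truncRows (N : ℕ) (r : ℕ → ℕ) (T : ℕ → ℕ → ℕ) (i : Fin N) : ℕ :=
  ((Finset.range (r i)).filter fun j => T i j ≤ N).card

theorem lt_card_filter_range_iff {p : ℕ → Prop} [DecidablePred p] {n : ℕ}
    (hp : ∀ j k, j < k → k < n → p k → p j) (j : ℕ) :
    j < ((Finset.range n).filter p).card ↔ j < n ∧ p j := by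
  constructor
  · intro h
    by_contra hc
    have hsub : (Finset.range n).filter p ⊆ Finset.range j := by
      intro k hk
      rw [Finset.mem_filter, Finset.mem_range] at hk
      rw [Finset.mem_range]
      by_contra hkj
      rcases (not_lt.mp hkj).eq_or_lt with rfl | hlt
      · exact hc hk
      · exact hc ⟨hlt.trans hk.1, hp j k hlt hk.1 hk.2⟩
    have := Finset.card_le_card hsub
    rw [Finset.card_range] at this
    omega
  · rintro ⟨h1, h2⟩
    have hsub : Finset.range (j + 1) ⊆ (Finset.range n).filter p := by
      intro k hk
      rw [Finset.mem_range] at hk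
      rw [Finset.mem_filter, Finset.mem_range]
      rcases (Nat.lt_succ_iff.mp hk).eq_or_lt with rfl | hlt
      · exact ⟨h1, h2⟩
      · exact ⟨hlt.trans h1, hp k j hlt h1 h2⟩
    have := Finset.card_le_card hsub
    rw [Finset.card_range] at this
    omega

theorem IsTableau.lt_extendRows_truncRows {N : ℕ} {r : ℕ → ℕ} {T : ℕ → ℕ → ℕ}
    (hT : IsTableau (N + 1) r T) (hr : Antitone r) (i j : ℕ) :
    j < extendRows (truncRows N r T) i ↔ j < r i ∧ T i j ≤ N := by
  unfold extendRows
  split_ifs with h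
  · exact lt_card_filter_range_iff (p := fun j => T i j ≤ N)
      (fun j k hjk hk h => (hT.row_weak hjk hk).trans h) j
  · refine iff_of_false (by simp) fun hc => ?_
    have := hT.lt_entry hr hc.1
    omega

theorem IsTableau.truncRows_mem {N : ℕ} {r : ℕ → ℕ} {T : ℕ → ℕ → ℕ}
    (hT : IsTableau (N + 1) r T) (hr : Antitone r) : truncRows N r T ∈ interlacing N r := by
  refine Fintype.mem_piFinset.mpr fun i => Finset.mem_Icc.mpr ⟨?_, ?_⟩
  · by_contra! hc
    have e : extendRows (truncRows N r T) i = truncRows N r T i := by simp [extendRows]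
    have h := (hT.lt_extendRows_truncRows hr i (truncRows N r T i)).not.mp (by rw [e]; simp)
    refine h ⟨hc.trans_le (hr (Nat.le_succ _)), ?_⟩
    have h1 := hT.col_strict (Nat.lt_succ_self (i : ℕ)) hc
    have h2 := (Finset.mem_Icc.mp (hT.mem_Icc hc)).2
    simp only [Nat.succ_eq_add_one] at h1
    omega
  · exact (Finset.card_filter_le _ _).trans (by simp)

theorem IsTableau.truncate {N : ℕ} {r : ℕ → ℕ} {T : ℕ → ℕ → ℕ}
    (hT : IsTableau (N + 1) r T) (hr : Antitone r) :
    IsTableau N (extendRows (truncRows N r T))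
      fun i j => if j < extendRows (truncRows N r T) i then T i j else 0 := by
  have key := hT.lt_extendRows_truncRows hr
  refine ⟨fun {i j k} hjk hk => ?_, fun {i k j} hik hj => ?_, fun {i j} hj => ?_, fun {i j} hj => ?_⟩
  · simp only [if_pos hk, if_pos (hjk.trans hk)]
    exact hT.row_weak hjk ((key _ _).mp hk).1
  · obtain ⟨h1, h2⟩ := (key _ _).mp hj
    have h3 := hT.col_strict hik h1
    simp only [if_pos hj]
    rw [if_pos ((key _ _).mpr ⟨h1.trans_le (hr hik.le), by omega⟩)]
    exact h3
  · obtain ⟨h1, h2⟩ := (key _ _).mp hj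
    simp only [if_pos hj]
    exact Finset.mem_Icc.mpr ⟨(Finset.mem_Icc.mp (hT.mem_Icc h1)).1, h2⟩
  · exact if_neg hj.not_gt

theorem extendRows_bounds {N : ℕ} {r : ℕ → ℕ} {s : Fin N → ℕ} (hs : s ∈ interlacing N r) {i : ℕ}
    (hi : i < N) : r (i + 1) ≤ extendRows s i ∧ extendRows s i ≤ r i := by
  have := Finset.mem_Icc.mp (Fintype.mem_piFinset.mp hs ⟨i, hi⟩)
  simpa [extendRows, hi] using this

theorem extendRows_le {N : ℕ} {r : ℕ → ℕ} {s : Fin N → ℕ} (hs : s ∈ interlacing N r) (i : ℕ) :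
    extendRows s i ≤ r i := by
  by_cases hi : i < N
  · exact (extendRows_bounds hs hi).2
  · simp [extendRows, hi]

theorem extendRows_self {N : ℕ} (s : Fin N → ℕ) : extendRows s N = 0 := by simp [extendRows]

theorem antitone_extendRows {N : ℕ} {r : ℕ → ℕ} {s : Fin N → ℕ} (hs : s ∈ interlacing N r) :
    Antitone (extendRows s) := by
  refine antitone_nat_of_succ_le fun i => ?_
  by_cases hi : i + 1 < N
  · exact (extendRows_bounds hs hi).2.trans (extendRows_bounds hs (by omega)).1
  · simp [extendRows, hi]

theorem IsTableau.extend {N : ℕ} {r : ℕ → ℕ} (hr : Antitone r) (hrN : r (N + 1) = 0)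
    {s : Fin N → ℕ} (hs : s ∈ interlacing N r) {S : ℕ → ℕ → ℕ}
    (hS : IsTableau N (extendRows s) S) :
    IsTableau (N + 1) r
      fun i j => if j < extendRows s i then S i j else if j < r i then N + 1 else 0 := by
  have hle : ∀ i j, j < extendRows s i → S i j ≤ N := fun i j h =>
    (Finset.mem_Icc.mp (hS.mem_Icc h)).2
  refine ⟨fun {i j k} hjk hk => ?_, fun {i k j} hik hj => ?_, fun {i j} hj => ?_, fun {i j} hj => ?_⟩
  · simp only [if_pos hk, if_pos (hjk.trans hk)]
    split_ifs with h1 h2 h2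
    · exact hS.row_weak hjk h2
    · exact (hle _ _ h1).trans N.le_succ
    · omega
    · exact le_rfl
  · have hiN : i < N := by
      by_contra hc
      have := hr (show N + 1 ≤ k by omega)
      omega
    have h1 : j < extendRows s i :=
      (hj.trans_le (hr (Nat.succ_le_of_lt hik))).trans_le (extendRows_bounds hs hiN).1
    simp only [if_pos h1, if_pos hj]
    split_ifs with h2
    · exact hS.col_strict hik h2
    · exact Nat.lt_succ_of_le (hle _ _ h1)
  · simp only [if_pos hj]
    split_ifs with h
    · have := Finset.mem_Icc.mp (hS.mem_Icc h)
      exact Finset.mem_Icc.mpr ⟨this.1, this.2.trans N.le_succ⟩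
    · simp
  · have := extendRows_le hs i
    rw [if_neg (by omega), if_neg (by omega)]

theorem sigma_isTableau_ext {N : ℕ} {A : Finset (Fin N → ℕ)}
    {p q : Σ s : A, {S // IsTableau N (extendRows s.1) S}} (h1 : p.1.1 = q.1.1)
    (h2 : p.2.1 = q.2.1) : p = q := by
  obtain ⟨⟨s, hs⟩, S, hS⟩ := p
  obtain ⟨⟨t, ht⟩, T, hT⟩ := q
  dsimp only at h1 h2
  subst h1
  subst h2
  rfl

/-- Removing the entries `N + 1` from a tableau. -/
def tableauEquivSigma (N : ℕ) (r : ℕ → ℕ) (hr : Antitone r) (hrN : r (N + 1) = 0) :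
    {T // IsTableau (N + 1) r T} ≃
      Σ s : interlacing N r, {S // IsTableau N (extendRows s.1) S} where
  toFun T := ⟨⟨truncRows N r T.1, T.2.truncRows_mem hr⟩, ⟨_, T.2.truncate hr⟩⟩
  invFun p := ⟨_, p.2.2.extend hr hrN p.1.2⟩
  left_inv T := by
    refine Subtype.ext (funext fun i => funext fun j => ?_)
    dsimp only
    have key := T.2.lt_extendRows_truncRows hr i j
    split_ifs with h1 h2
    · rfl
    · have := Finset.mem_Icc.mp (T.2.mem_Icc h2)
      have := key.not.mp h1
      have : ¬ T.1 i j ≤ N := fun h => this ⟨h2, h⟩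
      omega
    · exact (T.2.zeros (not_lt.mp h2)).symm
  right_inv p := by
    obtain ⟨⟨s, hs⟩, S, hS⟩ := p
    have hT := hS.extend hr hrN hs
    have h1 : truncRows N r
        (fun i j => if j < extendRows s i then S i j else if j < r i then N + 1 else 0) = s := by
      funext i
      have key := hT.lt_extendRows_truncRows hr i
      have e : ∀ t : Fin N → ℕ, extendRows t i = t i := fun t => by simp [extendRows]
      refine eq_of_forall_lt_iff fun j => ?_
      rw [← e (truncRows N r _), key, ← e s]
      constructor
      · rintro ⟨h2, h3⟩
        by_contra h4
        simp [h4, h2] at h3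
      · intro h2
        refine ⟨h2.trans_le (extendRows_le hs i), ?_⟩
        simp only [if_pos h2]
        exact (Finset.mem_Icc.mp (hS.mem_Icc h2)).2
    refine sigma_isTableau_ext h1 ?_
    dsimp only
    funext i j
    rw [h1]
    split_ifs with h2
    · rfl
    · exact (hS.zeros (not_lt.mp h2)).symm

theorem isTableau_zero_iff {r : ℕ → ℕ} (hr : Antitone r) (h0 : r 0 = 0) (T : ℕ → ℕ → ℕ) :
    IsTableau 0 r T ↔ T = 0 := by
  have h : ∀ i, r i = 0 := fun i => by
    have := hr (Nat.zero_le i)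
    omega
  constructor
  · intro hT
    funext i j
    exact hT.zeros (by simp [h])
  · rintro rfl
    exact ⟨fun _ hk => by simp [h] at hk, fun _ hk => by simp [h] at hk,
      fun hk => by simp [h] at hk, fun _ => rfl⟩

theorem finite_isTableau (N : ℕ) (r : ℕ → ℕ) (hr : Antitone r) : Finite {T // IsTableau N r T} := by
  by_cases hrN : r N = 0
  · induction N generalizing r with
    | zero =>
      simp only [isTableau_zero_iff hr hrN]
      infer_instance
    | succ N ih =>
      have := fun s : interlacing N r =>
        ih (extendRows s.1) (antitone_extendRows s.2) (extendRows_self s.1)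
      exact Finite.of_equiv _ (tableauEquivSigma N r hr hrN).symm
  · have : IsEmpty {T // IsTableau N r T} := ⟨fun T => hrN (T.2.row_eq_zero hr)⟩
    infer_instance

theorem card_isTableau_succ (N : ℕ) (r : ℕ → ℕ) (hr : Antitone r) (hrN : r (N + 1) = 0) :
    Nat.card {T // IsTableau (N + 1) r T}
      = ∑ s ∈ interlacing N r, Nat.card {S // IsTableau N (extendRows s) S} := by
  have := fun s : interlacing N r => finite_isTableau N _ (antitone_extendRows s.2)
  rw [Nat.card_congr (tableauEquivSigma N r hr hrN), Nat.card_sigma]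
  exact Finset.sum_coe_sort (interlacing N r)
    fun s => Nat.card {S // IsTableau N (extendRows s) S}

/-- The determinant of the falling factorials of the shifted row lengths. -/
def descFactorialDet (N : ℕ) (r : ℕ → ℕ) : ℝ :=
  (Matrix.of fun i j : Fin N => ((r i + (N - 1 - i)).descFactorial j : ℝ)).det

/-- The shifted row lengths. -/
def shiftedRow (N : ℕ) (r : ℕ → ℕ) (i : ℕ) : ℝ := (r i : ℝ) + N - 1 - i

theorem descFactorialDet_eq_vdet (N : ℕ) (r : ℕ → ℕ) :
    descFactorialDet N r = vdet N (shiftedRow N r) := by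
  unfold descFactorialDet vdet
  rw [Matrix.det_eval_matrixOfPolynomials_eq_det_vandermonde _
    (fun j : Fin N => descPochhammer ℝ j) (fun i => descPochhammer_natDegree ℝ _)
    (fun i => monic_descPochhammer ℝ _)]
  congr 1
  ext i j
  simp only [Matrix.of_apply]
  rw [← descPochhammer_eval_eq_descFactorial ℝ]
  congr 1
  have : (i : ℕ) + 1 ≤ N := i.2
  rw [shiftedRow, Nat.cast_add, Nat.sub_sub, Nat.cast_sub (by omega)]
  push_cast
  ring

theorem sum_Ico_descFactorial (a b j : ℕ) (hab : a ≤ b) :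
    ∑ t ∈ Finset.Ico a b, (t.descFactorial j : ℝ)
      = (b.descFactorial (j + 1) - a.descFactorial (j + 1)) * ((j : ℝ) + 1)⁻¹ := by
  induction b, hab using Nat.le_induction with
  | base => simp
  | succ b hab ih =>
    rw [Finset.sum_Ico_succ_top hab, ih, Nat.succ_descFactorial_succ]
    have h1 : (b.descFactorial (j + 1) : ℝ) = ((b : ℝ) - j) * b.descFactorial j := by
      rw [Nat.descFactorial_succ]
      rcases le_or_gt j b with h | h
      · push_cast [h]
        ring
      · simp [Nat.descFactorial_of_lt h]
    have h2 : (j : ℝ) + 1 ≠ 0 := by positivity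
    push_cast
    rw [h1]
    field_simp
    ring

theorem sum_descFactorialDet (N : ℕ) (r : ℕ → ℕ) (hr : Antitone r) :
    ∑ s ∈ interlacing N r, descFactorialDet N (extendRows s)
      = ((∏ j : Fin N, ((j : ℝ) + 1)⁻¹) * (-1) ^ N) * descFactorialDet (N + 1) r := by
  have h1 : ∑ s ∈ interlacing N r, descFactorialDet N (extendRows s)
      = (Matrix.of fun i j : Fin N => ((j : ℝ) + 1)⁻¹ *
        (((r i + (N - i)).descFactorial (j + 1) : ℝ)
          - (r (i + 1) + (N - (i + 1))).descFactorial (j + 1))).det := by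
    have := (Matrix.detRowAlternating (R := ℝ) (n := Fin N)).toMultilinearMap.map_sum_finset
      (fun (i : Fin N) (t : ℕ) (j : Fin N) => ((t + (N - 1 - i)).descFactorial j : ℝ))
      (fun i : Fin N => Finset.Icc (r (i + 1)) (r i))
    have e : ∑ s ∈ interlacing N r, descFactorialDet N (extendRows s)
      = ∑ s ∈ interlacing N r, Matrix.det (fun i j : Fin N =>
        ((s i + (N - 1 - i)).descFactorial j : ℝ)) := by
      refine Finset.sum_congr rfl fun s _ => ?_
      unfold descFactorialDet
      congr 1
      ext i j
      simp [extendRows]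
    rw [e]
    refine this.symm.trans ?_
    change Matrix.det _ = _
    congr 1
    ext i j
    have hi := i.2
    rw [Finset.sum_apply, Matrix.of_apply]
    have h := sum_Ico_descFactorial (r (i + 1) + (N - (i + 1))) (r i + (N - i)) j
      (by have := hr (Nat.le_succ (i : ℕ)); simp only [Nat.succ_eq_add_one] at this; omega)
    rw [mul_comm, ← h]
    have := Finset.sum_Ico_add' (fun t => (t.descFactorial j : ℝ)) (r (i + 1)) (r i + 1) (N - 1 - i)
    rw [show r (i + 1) + (N - (i + 1)) = r (i + 1) + (N - 1 - i) by omega,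
      show r i + (N - i) = r i + 1 + (N - 1 - i) by omega, ← this]
    rfl
  have h2 : descFactorialDet (N + 1) r = (Matrix.of fun i j : Fin (N + 1) =>
      Fin.cases (motive := fun _ => ℝ) ((r 0 + N).descFactorial j : ℝ)
        (fun k : Fin N => ((r (k + 1) + (N - (k + 1))).descFactorial j : ℝ)
          - (r k + (N - k)).descFactorial j) i).det := by
    refine Matrix.det_eq_of_forall_row_eq_smul_add_pred (fun _ => 1) (fun j => ?_) fun i j => ?_
    · simp
    · simp
  rw [h1, h2, Matrix.det_succ_column_zero, Fin.sum_univ_succ, Finset.sum_eq_zero (by simp)]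
  refine (Matrix.det_mul_row (fun j : Fin N => ((j : ℝ) + 1)⁻¹) (Matrix.of fun i j : Fin N =>
    (((r i + (N - i)).descFactorial (j + 1) : ℝ)
      - (r (i + 1) + (N - (i + 1))).descFactorial (j + 1)))).trans ?_
  rw [mul_assoc]
  congr 1
  rw [← neg_neg (Matrix.of _), Matrix.det_neg, Fintype.card_fin]
  congr 1
  simp only [Fin.val_zero, pow_zero, one_mul, add_zero, Matrix.of_apply, Fin.cases_zero,
    Nat.descFactorial_zero, Nat.cast_one]
  congr 1
  ext i j
  simp

theorem exists_card_isTableau_eq (N : ℕ) : ∃ c : ℝ, ∀ r : ℕ → ℕ, Antitone r → r N = 0 →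
    (Nat.card {T // IsTableau N r T} : ℝ) = c * vdet N (shiftedRow N r) := by
  simp only [← descFactorialDet_eq_vdet]
  induction N with
  | zero =>
    refine ⟨1, fun r hr h0 => ?_⟩
    simp only [isTableau_zero_iff hr h0]
    simp [descFactorialDet]
  | succ N ih =>
    obtain ⟨c, hc⟩ := ih
    refine ⟨c * ((∏ j : Fin N, ((j : ℝ) + 1)⁻¹) * (-1) ^ N), fun r hr hrN => ?_⟩
    rw [card_isTableau_succ N r hr hrN, mul_assoc, ← sum_descFactorialDet N r hr, Nat.cast_sum,
      Finset.mul_sum]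
    exact Finset.sum_congr rfl fun s hs => hc _ (antitone_extendRows hs) (extendRows_self s)

theorem mul_sum_eq_sum_sum_filter {α ι : Type*} [DecidableEq α] (S S' : Finset α) (J : Finset ι)
    (up : ι → α → α) (hup : ∀ i, Function.Injective (up i)) (D : α → ℝ) (u v : α → ι → ℝ) (p : ℝ)
    (hu : ∀ ν ∈ S', ∑ i ∈ J, u ν i = p)
    (h1 : ∀ ν ∈ S', ∀ i ∈ J, u ν i ≠ 0 → ∃ κ ∈ S, up i κ = ν)
    (h2 : ∀ κ ∈ S, ∀ i ∈ J, up i κ ∈ S' → D (up i κ) * u (up i κ) i = D κ * v κ i) :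
    p * ∑ ν ∈ S', D ν = ∑ i ∈ J, ∑ κ ∈ S with up i κ ∈ S', D κ * v κ i := by
  have e : p * ∑ ν ∈ S', D ν = ∑ i ∈ J, ∑ ν ∈ S', D ν * u ν i := by
    rw [Finset.sum_comm, Finset.mul_sum]
    refine Finset.sum_congr rfl fun ν hν => ?_
    rw [← Finset.mul_sum, hu ν hν, mul_comm]
  rw [e]
  refine Finset.sum_congr rfl fun i hi => ?_
  have himg : ((S.filter fun κ => up i κ ∈ S').image (up i)) ⊆ S' := by
    intro ν hν
    obtain ⟨κ, hκ, rfl⟩ := Finset.mem_image.mp hν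
    exact (Finset.mem_filter.mp hκ).2
  rw [← Finset.sum_subset himg, Finset.sum_image fun κ _ κ' _ h => hup i h]
  · refine Finset.sum_congr rfl fun κ hκ => ?_
    exact h2 κ (Finset.mem_filter.mp hκ).1 i hi (Finset.mem_filter.mp hκ).2
  · intro ν hν hν'
    by_contra hc
    obtain ⟨κ, hκ, rfl⟩ := h1 ν hν i hi (right_ne_zero_of_mul hc)
    exact hν' (Finset.mem_image_of_mem _ (Finset.mem_filter.mpr ⟨hκ, hν⟩))

theorem mul_sum_le_mul_sum {α ι : Type*} [DecidableEq α] (S S' : Finset α) (J : Finset ι)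
    (up : ι → α → α) (hup : ∀ i, Function.Injective (up i)) (D : α → ℝ) (u v : α → ι → ℝ)
    (p q : ℝ) (hu : ∀ ν ∈ S', ∑ i ∈ J, u ν i = p) (hv : ∀ κ ∈ S, ∑ i ∈ J, v κ i = q)
    (h1 : ∀ ν ∈ S', ∀ i ∈ J, u ν i ≠ 0 → ∃ κ ∈ S, up i κ = ν)
    (h2 : ∀ κ ∈ S, ∀ i ∈ J, up i κ ∈ S' → D (up i κ) * u (up i κ) i = D κ * v κ i)
    (h3 : ∀ κ ∈ S, ∀ i ∈ J, 0 ≤ D κ * v κ i) :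
    p * ∑ ν ∈ S', D ν ≤ q * ∑ κ ∈ S, D κ := by
  rw [mul_sum_eq_sum_sum_filter S S' J up hup D u v p hu h1 h2]
  have e : q * ∑ κ ∈ S, D κ = ∑ i ∈ J, ∑ κ ∈ S, D κ * v κ i := by
    rw [Finset.sum_comm, Finset.mul_sum]
    refine Finset.sum_congr rfl fun κ hκ => ?_
    rw [← Finset.mul_sum, hv κ hκ, mul_comm]
  rw [e]
  refine Finset.sum_le_sum fun i hi => ?_
  exact Finset.sum_le_sum_of_subset_of_nonneg (Finset.filter_subset _ _)
    fun κ hκ _ => h3 κ hκ i hi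

theorem mul_sum_eq_mul_sum {α ι : Type*} [DecidableEq α] (S S' : Finset α) (J : Finset ι)
    (up : ι → α → α) (hup : ∀ i, Function.Injective (up i)) (D : α → ℝ) (u v : α → ι → ℝ)
    (p q : ℝ) (hu : ∀ ν ∈ S', ∑ i ∈ J, u ν i = p) (hv : ∀ κ ∈ S, ∑ i ∈ J, v κ i = q)
    (h1 : ∀ ν ∈ S', ∀ i ∈ J, u ν i ≠ 0 → ∃ κ ∈ S, up i κ = ν)
    (h2 : ∀ κ ∈ S, ∀ i ∈ J, up i κ ∈ S' → D (up i κ) * u (up i κ) i = D κ * v κ i)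
    (h4 : ∀ κ ∈ S, ∀ i ∈ J, v κ i ≠ 0 → up i κ ∈ S') :
    p * ∑ ν ∈ S', D ν = q * ∑ κ ∈ S, D κ := by
  rw [mul_sum_eq_sum_sum_filter S S' J up hup D u v p hu h1 h2]
  have e : q * ∑ κ ∈ S, D κ = ∑ i ∈ J, ∑ κ ∈ S, D κ * v κ i := by
    rw [Finset.sum_comm, Finset.mul_sum]
    refine Finset.sum_congr rfl fun κ hκ => ?_
    rw [← Finset.mul_sum, hv κ hκ, mul_comm]
  rw [e]
  refine Finset.sum_congr rfl fun i hi => Finset.sum_filter_of_ne fun κ hκ hne => ?_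
  exact h4 κ hκ i hi (right_ne_zero_of_mul hne)

/-- The number of cells in the rows `0, 2, 4, …`, all of which have index less than `N`. -/
def evenRowSum (N : ℕ) (r : ℕ → ℕ) : ℕ := ∑ a ∈ Finset.range ((N + 1) / 2), r (2 * a)

/-- The number of cells in the rows `1, 3, 5, …`, all of which have index less than `N`. -/
def oddRowSum (N : ℕ) (r : ℕ → ℕ) : ℕ := ∑ b ∈ Finset.range (N / 2), r (2 * b + 1)

/-- `r` is the sequence of row lengths of a diagram of size `2j+m` with `m` odd columns and at most
`min N l` rows. -/
structure IsShape (N l j m : ℕ) (r : ℕ → ℕ) : Prop where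
  antitone : Antitone r
  row_self : r N = 0
  row_bound : r l = 0
  evenRowSum_eq : evenRowSum N r = j + m
  oddRowSum_eq : oddRowSum N r = j

theorem evenRowSum_add_single (N : ℕ) (r : ℕ → ℕ) (a : ℕ) (ha : a < (N + 1) / 2) :
    evenRowSum N (r + Pi.single (2 * a) 1) = evenRowSum N r + 1 := by
  simp only [evenRowSum, Pi.add_apply, Finset.sum_add_distrib, Pi.single_apply]
  congr 1
  simp [ha]

theorem oddRowSum_add_single_even (N : ℕ) (r : ℕ → ℕ) (a : ℕ) :
    oddRowSum N (r + Pi.single (2 * a) 1) = oddRowSum N r := by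
  simp only [oddRowSum, Pi.add_apply, Pi.single_apply]
  refine Finset.sum_congr rfl fun b _ => ?_
  rw [if_neg (by omega), add_zero]

theorem oddRowSum_add_single (N : ℕ) (r : ℕ → ℕ) (b : ℕ) (hb : b < N / 2) :
    oddRowSum N (r + Pi.single (2 * b + 1) 1) = oddRowSum N r + 1 := by
  simp only [oddRowSum, Pi.add_apply, Finset.sum_add_distrib, Pi.single_apply]
  congr 1
  simp [hb]

theorem evenRowSum_add_single_odd (N : ℕ) (r : ℕ → ℕ) (b : ℕ) :
    evenRowSum N (r + Pi.single (2 * b + 1) 1) = evenRowSum N r := by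
  simp only [evenRowSum, Pi.add_apply, Pi.single_apply]
  refine Finset.sum_congr rfl fun b _ => ?_
  rw [if_neg (by omega), add_zero]

theorem finite_isShape (N l j m : ℕ) : {r | IsShape N l j m r}.Finite := by
  have hinj : Set.InjOn (fun (r : ℕ → ℕ) (i : Fin N) => r i) {r | IsShape N l j m r} := by
    intro r hr s hs h
    funext i
    by_cases hi : i < N
    · exact congrFun h ⟨i, hi⟩
    · have h1 := hr.antitone (not_lt.mp hi)
      have h2 := hs.antitone (not_lt.mp hi)
      rw [hr.row_self] at h1
      rw [hs.row_self] at h2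
      omega
  refine Set.Finite.of_finite_image (Set.Finite.subset
    (Fintype.piFinset fun _ : Fin N => Finset.range (j + m + 1)).finite_toSet ?_) hinj
  rintro _ ⟨r, hr, rfl⟩
  refine Finset.mem_coe.mpr (Fintype.mem_piFinset.mpr fun i => Finset.mem_range.mpr ?_)
  have hi := i.2
  have h1 : r 0 ≤ evenRowSum N r :=
    Finset.single_le_sum (f := fun a => r (2 * a)) (fun _ _ => Nat.zero_le _)
      (Finset.mem_range.mpr (show 0 < (N + 1) / 2 by omega))
  have h2 := hr.antitone (Nat.zero_le (i : ℕ))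
  have h3 := hr.evenRowSum_eq
  change r i < j + m + 1
  omega

/-- The finite set of row length sequences satisfying `IsShape`. -/
def shapes (N l j m : ℕ) : Finset (ℕ → ℕ) := (finite_isShape N l j m).toFinset

theorem mem_shapes {N l j m : ℕ} {r : ℕ → ℕ} : r ∈ shapes N l j m ↔ IsShape N l j m r := by
  simp [shapes]

theorem shiftedRow_add_single (N : ℕ) (r : ℕ → ℕ) (i : ℕ) :
    shiftedRow N (r + Pi.single i 1) = Function.update (shiftedRow N r) i (shiftedRow N r i + 1) := by
  funext k
  rcases eq_or_ne k i with rfl | h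
  · simp only [shiftedRow, Pi.add_apply, Pi.single_eq_same, Function.update_self]
    push_cast
    ring
  · simp [shiftedRow, Function.update_of_ne h, Pi.single_eq_of_ne h]

theorem shiftedRow_add_le {N : ℕ} {r : ℕ → ℕ} (hr : Antitone r) {i k : ℕ} (h : i < k) :
    shiftedRow N r k + 1 ≤ shiftedRow N r i := by
  have h1 : (r k : ℝ) ≤ r i := by exact_mod_cast hr h.le
  have h2 : (i : ℝ) + 1 ≤ k := by exact_mod_cast h
  unfold shiftedRow
  linarith

theorem shiftedRow_nonneg {N : ℕ} (r : ℕ → ℕ) {i : ℕ} (h : i < N) : 0 ≤ shiftedRow N r i := by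
  have h1 : (0 : ℝ) ≤ r i := Nat.cast_nonneg _
  have h2 : (i : ℝ) + 1 ≤ N := by exact_mod_cast h
  unfold shiftedRow
  linarith

theorem shiftedRow_injective {N : ℕ} {r : ℕ → ℕ} (hr : Antitone r) :
    Function.Injective (shiftedRow N r) := by
  intro i k h
  by_contra hne
  rcases lt_or_gt_of_ne hne with h' | h'
  · linarith [shiftedRow_add_le (N := N) hr h']
  · linarith [shiftedRow_add_le (N := N) hr h']

/-- The weight of the even row `2 * a` of the diagram with row lengths `r`. -/
def rowWeight (N : ℕ) (e c : ℝ) (r : ℕ → ℕ) (a : ℕ) : ℝ :=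
  boxWeight N e c (fun k => shiftedRow N r (2 * k)) (fun k => shiftedRow N r (2 * k + 1)) a

/-- The weight of the pair of rows `2 * a` and `2 * b + 1` of the diagram with row lengths `r`. -/
def rowPairWeight (N : ℕ) (e c : ℝ) (r : ℕ → ℕ) (p : ℕ × ℕ) : ℝ :=
  pairWeight N e c (fun k => shiftedRow N r (2 * k)) (fun k => shiftedRow N r (2 * k + 1)) p.1 p.2

theorem sum_range_arith (n : ℕ) (t : ℝ) :
    ∑ a ∈ Finset.range n, (t - 2 * (a : ℝ)) = n * (t + 1 - n) := by
  induction n with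
  | zero => simp
  | succ n ih =>
    rw [Finset.sum_range_succ, ih]
    push_cast
    ring

theorem sum_shiftedRow_even (N : ℕ) (r : ℕ → ℕ) :
    ∑ a ∈ Finset.range ((N + 1) / 2), shiftedRow N r (2 * a)
      = evenRowSum N r + ((N + 1) / 2 : ℕ) * ((N : ℝ) - ((N + 1) / 2 : ℕ)) := by
  have h := sum_range_arith ((N + 1) / 2) ((N : ℝ) - 1)
  rw [sub_add_cancel] at h
  rw [← h, evenRowSum, Nat.cast_sum, ← Finset.sum_add_distrib]
  refine Finset.sum_congr rfl fun a _ => ?_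
  unfold shiftedRow
  push_cast
  ring

theorem sum_shiftedRow_odd (N : ℕ) (r : ℕ → ℕ) :
    ∑ b ∈ Finset.range (N / 2), shiftedRow N r (2 * b + 1)
      = oddRowSum N r + (N / 2 : ℕ) * ((N : ℝ) - 1 - (N / 2 : ℕ)) := by
  have h := sum_range_arith (N / 2) ((N : ℝ) - 2)
  rw [show (N : ℝ) - 2 + 1 = N - 1 by ring] at h
  rw [← h, oddRowSum, Nat.cast_sum, ← Finset.sum_add_distrib]
  refine Finset.sum_congr rfl fun a _ => ?_
  unfold shiftedRow
  push_cast
  ring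

theorem injOn_shiftedRow_even {N : ℕ} {r : ℕ → ℕ} (hr : Antitone r) (s : Set ℕ) :
    Set.InjOn (fun k => shiftedRow N r (2 * k)) s := fun a _ b _ h => by
  have := shiftedRow_injective hr h
  omega

theorem injOn_shiftedRow_odd {N : ℕ} {r : ℕ → ℕ} (hr : Antitone r) (s : Set ℕ) :
    Set.InjOn (fun k => shiftedRow N r (2 * k + 1)) s := fun a _ b _ h => by
  have := shiftedRow_injective hr h
  omega

theorem sum_rowWeight_neg_one {N l j m : ℕ} {r : ℕ → ℕ} (hr : IsShape N l j m r) :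
    ∑ a ∈ Finset.range ((N + 1) / 2), rowWeight N (-1) 0 r a = m := by
  unfold rowWeight
  rw [sum_boxWeight _ _ _ _ _ (injOn_shiftedRow_even hr.antitone _), sum_shiftedRow_even,
    sum_shiftedRow_odd, hr.evenRowSum_eq, hr.oddRowSum_eq]
  rcases Nat.even_or_odd' N with ⟨q, rfl | rfl⟩
  · rw [show (2 * q + 1) / 2 = q by omega, show 2 * q / 2 = q by omega, if_pos (by simp)]
    push_cast
    ring
  · rw [show (2 * q + 1 + 1) / 2 = q + 1 by omega, show (2 * q + 1) / 2 = q by omega, ite_self]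
    push_cast
    ring

theorem sum_rowWeight_one {N l j m : ℕ} {r : ℕ → ℕ} (hr : IsShape N l j m r) :
    ∑ a ∈ Finset.range ((N + 1) / 2), rowWeight N 1 1 r a = m + N := by
  unfold rowWeight
  rw [sum_boxWeight _ _ _ _ _ (injOn_shiftedRow_even hr.antitone _), sum_shiftedRow_even,
    sum_shiftedRow_odd, hr.evenRowSum_eq, hr.oddRowSum_eq]
  rcases Nat.even_or_odd' N with ⟨q, rfl | rfl⟩
  · rw [show (2 * q + 1) / 2 = q by omega, show 2 * q / 2 = q by omega, if_pos (by simp)]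
    push_cast
    ring
  · rw [show (2 * q + 1 + 1) / 2 = q + 1 by omega, show (2 * q + 1) / 2 = q by omega,
      if_neg (by simp)]
    push_cast
    ring

theorem sum_rowPairWeight_neg_one {N l j m : ℕ} {r : ℕ → ℕ} (hr : IsShape N l j m r) :
    ∑ p ∈ Finset.range ((N + 1) / 2) ×ˢ Finset.range (N / 2), rowPairWeight N (-1) 0 r p = j := by
  unfold rowPairWeight
  rw [Finset.sum_product_right, sum_pairWeight _ _ _ _ _ (injOn_shiftedRow_even hr.antitone _)
    (injOn_shiftedRow_odd hr.antitone _), sum_shiftedRow_odd, hr.oddRowSum_eq]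
  rcases Nat.even_or_odd' N with ⟨q, rfl | rfl⟩
  · rw [show 2 * q / 2 = q by omega, if_pos (by simp)]
    push_cast
    ring
  · rw [show (2 * q + 1) / 2 = q by omega, if_neg (by simp)]
    push_cast
    ring

theorem sum_rowPairWeight_one {N l j m : ℕ} {r : ℕ → ℕ} (hr : IsShape N l j m r) :
    ∑ p ∈ Finset.range ((N + 1) / 2) ×ˢ Finset.range (N / 2), rowPairWeight N 1 1 r p
      = j + N * (N - 1) / 2 := by
  unfold rowPairWeight
  rw [Finset.sum_product_right, sum_pairWeight _ _ _ _ _ (injOn_shiftedRow_even hr.antitone _)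
    (injOn_shiftedRow_odd hr.antitone _), sum_shiftedRow_odd, hr.oddRowSum_eq]
  rcases Nat.even_or_odd' N with ⟨q, rfl | rfl⟩
  · rw [show 2 * q / 2 = q by omega, if_pos (by simp)]
    push_cast
    ring
  · rw [show (2 * q + 1) / 2 = q by omega, if_neg (by simp)]
    push_cast
    ring

theorem rowWeight_nonneg {N : ℕ} {r : ℕ → ℕ} (hr : Antitone r) {a : ℕ} (ha : a < (N + 1) / 2) :
    0 ≤ rowWeight N 1 1 r a := by
  have h0 := fun {i : ℕ} (h : i < N) => shiftedRow_nonneg r h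
  have h1 := fun {i k : ℕ} (h : i < k) => shiftedRow_add_le (N := N) hr h
  refine boxWeight_nonneg N _ _ a ha (h0 (by omega)) (fun i k hik _ => ?_) (fun i k hik _ => ?_)
    (fun i k hik _ => ?_)
  · linarith [h1 (show 2 * i < 2 * k by omega)]
  · linarith [h1 (show 2 * i < 2 * k + 1 by omega)]
  · exact h1 (by omega)

theorem rowPairWeight_nonneg {N : ℕ} {r : ℕ → ℕ} (hr : Antitone r) {p : ℕ × ℕ}
    (ha : p.1 < (N + 1) / 2) (hb : p.2 < N / 2) : 0 ≤ rowPairWeight N 1 1 r p := by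
  have h0 := fun {i : ℕ} (h : i < N) => shiftedRow_nonneg r h
  have h1 := fun {i k : ℕ} (h : i < k) => shiftedRow_add_le (N := N) hr h
  refine pairWeight_nonneg N _ _ p.1 p.2 ha hb (h0 (by omega)) (h0 (by omega))
    (fun i k hik _ => ?_) (fun i k hik _ => ?_) (fun i k hik _ => ?_) (fun i k hik _ => ?_)
  · linarith [h1 (show 2 * i < 2 * k by omega)]
  · linarith [h1 (show 2 * i + 1 < 2 * k + 1 by omega)]
  · exact h1 (by omega)
  · exact h1 (by omega)

theorem lt_of_rowWeight_ne_zero {N : ℕ} {r : ℕ → ℕ} (hr : Antitone r) (hrN : r N = 0) {a : ℕ}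
    (ha : a < (N + 1) / 2) (h : rowWeight N (-1) 0 r a ≠ 0) : r (2 * a + 1) < r (2 * a) := by
  refine lt_of_le_of_ne (hr (Nat.le_succ _)) fun he => h ?_
  unfold rowWeight boxWeight
  by_cases h1 : 2 * a + 1 < N
  · rw [Finset.prod_eq_zero (Finset.mem_range.mpr (show a < N / 2 by omega)), mul_zero, zero_div]
    simp only [shiftedRow, he]
    push_cast
    ring
  · have hN : N = 2 * a + 1 := by omega
    have h2 : r (2 * a) = 0 := by rw [← he, ← hN, hrN]
    rw [if_neg (by simp [hN]), show shiftedRow N r (2 * a) + 0 = 0 by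
      simp [shiftedRow, h2, hN], zero_mul, zero_div]

theorem lt_of_rowWeight_one_ne_zero {N : ℕ} {r : ℕ → ℕ} (hr : Antitone r) {a : ℕ}
    (ha : a < (N + 1) / 2) (h : rowWeight N 1 1 r a ≠ 0) {i : ℕ} (hi : i + 1 = 2 * a) :
    r (i + 1) < r i := by
  obtain ⟨b, rfl⟩ : ∃ b, i = 2 * b + 1 := ⟨(i - 1) / 2, by omega⟩
  obtain rfl : a = b + 1 := by omega
  refine lt_of_le_of_ne (hr (Nat.le_succ _)) fun he => h ?_
  unfold rowWeight boxWeight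
  rw [Finset.prod_eq_zero (Finset.mem_range.mpr (show b < N / 2 by omega)), mul_zero, zero_div]
  beta_reduce
  rw [show 2 * (b + 1) = 2 * b + 1 + 1 by ring]
  simp only [shiftedRow, he]
  push_cast
  ring

theorem lt_of_rowPairWeight_ne_zero {N : ℕ} {r : ℕ → ℕ} (hr : Antitone r) (hrN : r N = 0)
    {p : ℕ × ℕ} (ha : p.1 < (N + 1) / 2) (hb : p.2 < N / 2) (h : rowPairWeight N (-1) 0 r p ≠ 0) :
    (p.1 ≠ p.2 → r (2 * p.1 + 1) < r (2 * p.1)) ∧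
      (p.1 ≠ p.2 + 1 → r (2 * p.2 + 1 + 1) < r (2 * p.2 + 1)) := by
  obtain ⟨a, b⟩ := p
  dsimp only at *
  refine ⟨fun hne => lt_of_le_of_ne (hr (Nat.le_succ _)) fun he => h ?_,
    fun hne => lt_of_le_of_ne (hr (Nat.le_succ _)) fun he => h ?_⟩
  · unfold rowPairWeight pairWeight
    dsimp only
    by_cases h1 : 2 * a + 1 < N
    · rw [Finset.prod_eq_zero (i := a) (by simp; omega), zero_mul, mul_zero, zero_div]
      simp only [shiftedRow, he]
      push_cast
      ring
    · have hN : N = 2 * a + 1 := by omega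
      have h2 : r (2 * a) = 0 := by rw [← he, ← hN, hrN]
      rw [if_neg (by simp [hN]), show shiftedRow N r (2 * a) + 0 = 0 by
        simp [shiftedRow, h2, hN], zero_mul, zero_div]
  · unfold rowPairWeight pairWeight
    dsimp only
    by_cases h1 : 2 * b + 2 < N
    · rw [Finset.prod_eq_zero (s := (Finset.range ((N + 1) / 2)).erase a) (i := b + 1)
        (by simp; omega), mul_zero, mul_zero, zero_div]
      rw [show 2 * (b + 1) = 2 * b + 1 + 1 by ring]
      simp only [shiftedRow, he]
      push_cast
      ring
    · have hN : N = 2 * b + 1 + 1 := by omega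
      have h2 : r (2 * b + 1) = 0 := by rw [← he, ← hN, hrN]
      rw [if_pos (by rw [hN]; exact ⟨b + 1, by ring⟩), show shiftedRow N r (2 * b + 1) + 0 = 0 by
        simp only [shiftedRow, h2, hN]; push_cast; ring, zero_mul, zero_div]

theorem lt_of_rowPairWeight_one_ne_zero {N : ℕ} {r : ℕ → ℕ} (hr : Antitone r)
    {p : ℕ × ℕ} (ha : p.1 < (N + 1) / 2) (hb : p.2 < N / 2) (h : rowPairWeight N 1 1 r p ≠ 0) :
    (∀ i, i + 1 = 2 * p.1 → p.1 ≠ p.2 + 1 → r (i + 1) < r i) ∧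
      (p.1 ≠ p.2 → r (2 * p.2 + 1) < r (2 * p.2)) := by
  obtain ⟨a, b⟩ := p
  dsimp only at *
  refine ⟨fun i hi hne => ?_, fun hne => ?_⟩
  · obtain ⟨k, rfl⟩ : ∃ k, i = 2 * k + 1 := ⟨(i - 1) / 2, by omega⟩
    obtain rfl : a = k + 1 := by omega
    refine lt_of_le_of_ne (hr (Nat.le_succ _)) fun he => h ?_
    unfold rowPairWeight pairWeight
    rw [Finset.prod_eq_zero (i := k) (by simp; omega), zero_mul, mul_zero, zero_div]
    dsimp only
    rw [show 2 * (k + 1) = 2 * k + 1 + 1 by ring]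
    simp only [shiftedRow, he]
    push_cast
    ring
  · refine lt_of_le_of_ne (hr (Nat.le_succ _)) fun he => h ?_
    unfold rowPairWeight pairWeight
    rw [Finset.prod_eq_zero (s := (Finset.range ((N + 1) / 2)).erase a) (i := b) (by simp; omega),
      mul_zero, mul_zero, zero_div]
    simp only [shiftedRow, he]
    push_cast
    ring

theorem IsShape.exists_add_single {N l j m : ℕ} {ν : ℕ → ℕ} (hν : IsShape N l j (m + 1) ν)
    {a : ℕ} (ha : a < (N + 1) / 2) (h : ν (2 * a + 1) < ν (2 * a)) :
    ∃ κ, IsShape N l j m κ ∧ κ + Pi.single (2 * a) 1 = ν := by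
  have e : ν - Pi.single (2 * a) 1 + Pi.single (2 * a) 1 = ν := by
    funext i
    simp only [Pi.add_apply, Pi.sub_apply, Pi.single_apply]
    split_ifs with hi
    · subst hi
      omega
    · omega
  refine ⟨ν - Pi.single (2 * a) 1, ⟨antitone_nat_of_succ_le fun i => ?_, ?_, ?_, ?_, ?_⟩, e⟩
  · have hi := hν.antitone i.le_succ
    simp only [Pi.sub_apply, Pi.single_apply]
    by_cases h1 : i = 2 * a
    · subst h1
      rw [if_neg (by omega), if_pos rfl]
      omega
    · rw [if_neg h1]
      exact (Nat.sub_le _ _).trans hi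
  · simp [hν.row_self]
  · simp [hν.row_bound]
  · have h1 := evenRowSum_add_single N (ν - Pi.single (2 * a) 1) a ha
    rw [e, hν.evenRowSum_eq] at h1
    omega
  · have h1 := oddRowSum_add_single_even N (ν - Pi.single (2 * a) 1) a
    rw [e, hν.oddRowSum_eq] at h1
    exact h1.symm

theorem IsShape.add_single {N j m : ℕ} {r : ℕ → ℕ} (hr : IsShape N N j m r) {a : ℕ}
    (ha : a < (N + 1) / 2) (h : ∀ i, i + 1 = 2 * a → r (i + 1) < r i) :
    IsShape N N j (m + 1) (r + Pi.single (2 * a) 1) := by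
  have hN : (r + Pi.single (2 * a) 1 : ℕ → ℕ) N = 0 := by
    rw [Pi.add_apply, Pi.single_eq_of_ne (by omega), hr.row_self, add_zero]
  refine ⟨antitone_nat_of_succ_le fun i => ?_, hN, hN, ?_, ?_⟩
  · have hi := hr.antitone i.le_succ
    have h' := h i
    simp only [Nat.succ_eq_add_one] at hi
    simp only [Pi.add_apply, Pi.single_apply]
    split_ifs <;> omega
  · rw [evenRowSum_add_single N r a ha, hr.evenRowSum_eq, add_assoc]
  · rw [oddRowSum_add_single_even, hr.oddRowSum_eq]

/-- Adding one box to each of the rows `2 * p.1` and `2 * p.2 + 1`. -/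
def addPair (p : ℕ × ℕ) (r : ℕ → ℕ) : ℕ → ℕ :=
  r + Pi.single (2 * p.1) 1 + Pi.single (2 * p.2 + 1) 1

theorem IsShape.exists_addPair {N l j m : ℕ} {ν : ℕ → ℕ} (hν : IsShape N l (j + 1) m ν)
    {p : ℕ × ℕ} (ha : p.1 < (N + 1) / 2) (hb : p.2 < N / 2)
    (h : (p.1 ≠ p.2 → ν (2 * p.1 + 1) < ν (2 * p.1)) ∧
      (p.1 ≠ p.2 + 1 → ν (2 * p.2 + 1 + 1) < ν (2 * p.2 + 1))) :
    ∃ κ, IsShape N l j m κ ∧ addPair p κ = ν := by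
  obtain ⟨a, b⟩ := p
  dsimp only at *
  obtain ⟨h1, h2⟩ := h
  have hle := fun i => hν.antitone (Nat.le_add_right i 1)
  have l1 := hle (2 * a)
  have l2 := hle (2 * b)
  have l3 := hle (2 * b + 1)
  have pos : 0 < ν (2 * a) ∧ 0 < ν (2 * b + 1) := by
    by_cases c1 : a = b
    · subst c1
      have := h2 (by omega)
      omega
    · have := h1 c1
      refine ⟨by omega, ?_⟩
      by_cases c2 : a = b + 1
      · subst c2
        rw [show 2 * b + 1 + 1 = 2 * (b + 1) by ring] at l3
        omega
      · have := h2 c2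
        omega
  have e : addPair (a, b) (ν - Pi.single (2 * a) 1 - Pi.single (2 * b + 1) 1) = ν := by
    funext i
    simp only [addPair, Pi.add_apply, Pi.sub_apply, Pi.single_apply]
    split_ifs with hi hj hj
    · omega
    · subst hi
      omega
    · subst hj
      omega
    · omega
  refine ⟨ν - Pi.single (2 * a) 1 - Pi.single (2 * b + 1) 1,
    ⟨antitone_nat_of_succ_le fun i => ?_, ?_, ?_, ?_, ?_⟩, e⟩
  · have hi := hle i
    simp only [Pi.sub_apply, Pi.single_apply]
    by_cases c1 : i = 2 * a
    · subst c1
      rw [if_neg (show ¬ 2 * a + 1 = 2 * a by omega), if_pos rfl,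
        if_neg (show ¬ 2 * a = 2 * b + 1 by omega)]
      by_cases c2 : a = b
      · rw [if_pos (by omega)]
        omega
      · have := h1 c2
        omega
    · rw [if_neg c1]
      by_cases c2 : i = 2 * b + 1
      · subst c2
        rw [if_neg (show ¬ 2 * b + 1 + 1 = 2 * b + 1 by omega), if_pos rfl]
        by_cases c3 : a = b + 1
        · rw [if_pos (by omega)]
          omega
        · have := h2 c3
          omega
      · rw [if_neg c2]
        omega
  · simp [hν.row_self]
  · simp [hν.row_bound]
  · have h1 := evenRowSum_add_single_odd N (ν - Pi.single (2 * a) 1 - Pi.single (2 * b + 1) 1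
      + Pi.single (2 * a) 1) b
    rw [evenRowSum_add_single N _ a ha] at h1
    have h2 := hν.evenRowSum_eq
    rw [← e, addPair] at h2
    dsimp only at h2
    omega
  · have h1 := oddRowSum_add_single N (ν - Pi.single (2 * a) 1 - Pi.single (2 * b + 1) 1
      + Pi.single (2 * a) 1) b hb
    rw [oddRowSum_add_single_even] at h1
    have h2 := hν.oddRowSum_eq
    rw [← e, addPair] at h2
    dsimp only at h2
    omega

theorem IsShape.addPair {N j m : ℕ} {r : ℕ → ℕ} (hr : IsShape N N j m r) {p : ℕ × ℕ}
    (ha : p.1 < (N + 1) / 2) (hb : p.2 < N / 2)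
    (h : (∀ i, i + 1 = 2 * p.1 → p.1 ≠ p.2 + 1 → r (i + 1) < r i) ∧
      (p.1 ≠ p.2 → r (2 * p.2 + 1) < r (2 * p.2))) :
    IsShape N N (j + 1) m (addPair p r) := by
  obtain ⟨a, b⟩ := p
  dsimp only at *
  obtain ⟨h1, h2⟩ := h
  unfold _root_.addPair
  have hN : (r + Pi.single (2 * a) 1 + Pi.single (2 * b + 1) 1 : ℕ → ℕ) N = 0 := by
    rw [Pi.add_apply, Pi.add_apply, Pi.single_eq_of_ne (by omega), Pi.single_eq_of_ne (by omega),
      hr.row_self, add_zero, add_zero]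
  refine ⟨antitone_nat_of_succ_le fun i => ?_, hN, hN, ?_, ?_⟩
  · have hi := hr.antitone (Nat.le_add_right i 1)
    have h1' := h1 i
    simp only [Pi.add_apply, Pi.single_apply]
    by_cases c1 : i = 2 * b
    · subst c1
      split_ifs <;> omega
    · split_ifs <;> omega
  · rw [evenRowSum_add_single_odd, evenRowSum_add_single N r a ha, hr.evenRowSum_eq]
    ring
  · rw [oddRowSum_add_single N _ b hb, oddRowSum_add_single_even, hr.oddRowSum_eq]

/-- The number of tableaux with row lengths `r` and entries in `{1, …, N}`, as a real number. -/
def tableauCount (N : ℕ) (r : ℕ → ℕ) : ℝ := Nat.card {T // IsTableau N r T}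

theorem tableauCount_nonneg (N : ℕ) (r : ℕ → ℕ) : 0 ≤ tableauCount N r := Nat.cast_nonneg _

theorem tableauCount_mul_rowWeight {N : ℕ} {r : ℕ → ℕ} (hr : Antitone r) (hrN : r N = 0) {a : ℕ}
    (ha : a < (N + 1) / 2) (hr' : Antitone (r + Pi.single (2 * a) 1 : ℕ → ℕ)) :
    tableauCount N (r + Pi.single (2 * a) 1) * rowWeight N (-1) 0 (r + Pi.single (2 * a) 1) a
      = tableauCount N r * rowWeight N 1 1 r a := by
  obtain ⟨c, hc⟩ := exists_card_isTableau_eq N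
  have hrN' : (r + Pi.single (2 * a) 1 : ℕ → ℕ) N = 0 := by
    rw [Pi.add_apply, Pi.single_eq_of_ne (by omega), hrN, add_zero]
  have h1 := (shiftedRow_injective (N := N) hr').injOn (s := Finset.range N)
  rw [shiftedRow_add_single] at h1
  have h := vdet_mul_boxWeight N (shiftedRow N r) a ha (shiftedRow_injective hr).injOn h1
  unfold tableauCount rowWeight
  rw [hc _ hr hrN, hc _ hr' hrN', shiftedRow_add_single, mul_assoc, h, mul_assoc]

theorem tableauCount_mul_rowPairWeight {N : ℕ} {r : ℕ → ℕ} (hr : Antitone r) (hrN : r N = 0)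
    {p : ℕ × ℕ} (ha : p.1 < (N + 1) / 2) (hb : p.2 < N / 2) (hr' : Antitone (addPair p r)) :
    tableauCount N (addPair p r) * rowPairWeight N (-1) 0 (addPair p r) p
      = tableauCount N r * rowPairWeight N 1 1 r p := by
  obtain ⟨c, hc⟩ := exists_card_isTableau_eq N
  have hrN' : addPair p r N = 0 := by
    unfold addPair
    rw [Pi.add_apply, Pi.add_apply, Pi.single_eq_of_ne (by omega), Pi.single_eq_of_ne (by omega),
      hrN, add_zero, add_zero]
  have e : shiftedRow N (addPair p r) = Function.update (Function.update (shiftedRow N r) (2 * p.1)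
      (shiftedRow N r (2 * p.1) + 1)) (2 * p.2 + 1) (shiftedRow N r (2 * p.2 + 1) + 1) := by
    unfold addPair
    rw [shiftedRow_add_single, shiftedRow_add_single, Function.update_of_ne (by omega)]
  have h := vdet_mul_pairWeight N (shiftedRow N r) p.1 p.2 ha hb (shiftedRow N (addPair p r)) e
    (shiftedRow_injective hr).injOn (shiftedRow_injective hr').injOn
  unfold tableauCount rowPairWeight
  rw [hc _ hr hrN, hc _ hr' hrN', mul_assoc, h, mul_assoc]

theorem row_sum_le (N l j m : ℕ) :
    ((m : ℝ) + 1) * ∑ r ∈ shapes N l j (m + 1), tableauCount N r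
      ≤ (m + N) * ∑ r ∈ shapes N l j m, tableauCount N r := by
  refine mul_sum_le_mul_sum _ _ (Finset.range ((N + 1) / 2))
    (fun a r => r + Pi.single (2 * a) 1) (fun a => add_left_injective _) _ (rowWeight N (-1) 0)
    (rowWeight N 1 1) _ _ (fun ν hν => ?_) (fun κ hκ => ?_) (fun ν hν a ha h => ?_)
    (fun κ hκ a ha h => ?_) fun κ hκ a ha => ?_
  · exact_mod_cast sum_rowWeight_neg_one (mem_shapes.mp hν)
  · exact sum_rowWeight_one (mem_shapes.mp hκ)
  · have hν := mem_shapes.mp hν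
    have ha := Finset.mem_range.mp ha
    simp only [mem_shapes]
    exact hν.exists_add_single ha (lt_of_rowWeight_ne_zero hν.antitone hν.row_self ha h)
  · have hκ := mem_shapes.mp hκ
    exact tableauCount_mul_rowWeight hκ.antitone hκ.row_self (Finset.mem_range.mp ha)
      (mem_shapes.mp h).antitone
  · exact mul_nonneg (tableauCount_nonneg _ _)
      (rowWeight_nonneg (mem_shapes.mp hκ).antitone (Finset.mem_range.mp ha))

theorem row_sum_eq (N j m : ℕ) :
    ((m : ℝ) + 1) * ∑ r ∈ shapes N N j (m + 1), tableauCount N r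
      = (m + N) * ∑ r ∈ shapes N N j m, tableauCount N r := by
  refine mul_sum_eq_mul_sum _ _ (Finset.range ((N + 1) / 2))
    (fun a r => r + Pi.single (2 * a) 1) (fun a => add_left_injective _) _ (rowWeight N (-1) 0)
    (rowWeight N 1 1) _ _ (fun ν hν => ?_) (fun κ hκ => ?_) (fun ν hν a ha h => ?_)
    (fun κ hκ a ha h => ?_) fun κ hκ a ha h => ?_
  · exact_mod_cast sum_rowWeight_neg_one (mem_shapes.mp hν)
  · exact sum_rowWeight_one (mem_shapes.mp hκ)
  · have hν := mem_shapes.mp hν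
    have ha := Finset.mem_range.mp ha
    simp only [mem_shapes]
    exact hν.exists_add_single ha (lt_of_rowWeight_ne_zero hν.antitone hν.row_self ha h)
  · have hκ := mem_shapes.mp hκ
    exact tableauCount_mul_rowWeight hκ.antitone hκ.row_self (Finset.mem_range.mp ha)
      (mem_shapes.mp h).antitone
  · have hκ := mem_shapes.mp hκ
    have ha := Finset.mem_range.mp ha
    exact mem_shapes.mpr
      (hκ.add_single ha fun i => lt_of_rowWeight_one_ne_zero hκ.antitone ha h)

theorem addPair_injective (p : ℕ × ℕ) : Function.Injective (addPair p) := fun _ _ h =>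
  add_right_cancel (add_right_cancel h)

theorem pair_sum_le (N l j m : ℕ) :
    ((j : ℝ) + 1) * ∑ r ∈ shapes N l (j + 1) m, tableauCount N r
      ≤ (j + N * (N - 1) / 2) * ∑ r ∈ shapes N l j m, tableauCount N r := by
  refine mul_sum_le_mul_sum _ _ (Finset.range ((N + 1) / 2) ×ˢ Finset.range (N / 2))
    addPair addPair_injective _ (rowPairWeight N (-1) 0)
    (rowPairWeight N 1 1) _ _ (fun ν hν => ?_) (fun κ hκ => ?_) (fun ν hν p hp h => ?_)
    (fun κ hκ p hp h => ?_) fun κ hκ p hp => ?_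
  · exact_mod_cast sum_rowPairWeight_neg_one (mem_shapes.mp hν)
  · exact sum_rowPairWeight_one (mem_shapes.mp hκ)
  · have hν := mem_shapes.mp hν
    simp only [Finset.mem_product, Finset.mem_range] at hp
    simp only [mem_shapes]
    exact hν.exists_addPair hp.1 hp.2
      (lt_of_rowPairWeight_ne_zero hν.antitone hν.row_self hp.1 hp.2 h)
  · have hκ := mem_shapes.mp hκ
    simp only [Finset.mem_product, Finset.mem_range] at hp
    exact tableauCount_mul_rowPairWeight hκ.antitone hκ.row_self hp.1 hp.2
      (mem_shapes.mp h).antitone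
  · simp only [Finset.mem_product, Finset.mem_range] at hp
    exact mul_nonneg (tableauCount_nonneg _ _)
      (rowPairWeight_nonneg (mem_shapes.mp hκ).antitone hp.1 hp.2)

theorem pair_sum_eq (N j m : ℕ) :
    ((j : ℝ) + 1) * ∑ r ∈ shapes N N (j + 1) m, tableauCount N r
      = (j + N * (N - 1) / 2) * ∑ r ∈ shapes N N j m, tableauCount N r := by
  refine mul_sum_eq_mul_sum _ _ (Finset.range ((N + 1) / 2) ×ˢ Finset.range (N / 2))
    addPair addPair_injective _ (rowPairWeight N (-1) 0)
    (rowPairWeight N 1 1) _ _ (fun ν hν => ?_) (fun κ hκ => ?_) (fun ν hν p hp h => ?_)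
    (fun κ hκ p hp h => ?_) fun κ hκ p hp h => ?_
  · exact_mod_cast sum_rowPairWeight_neg_one (mem_shapes.mp hν)
  · exact sum_rowPairWeight_one (mem_shapes.mp hκ)
  · have hν := mem_shapes.mp hν
    simp only [Finset.mem_product, Finset.mem_range] at hp
    simp only [mem_shapes]
    exact hν.exists_addPair hp.1 hp.2
      (lt_of_rowPairWeight_ne_zero hν.antitone hν.row_self hp.1 hp.2 h)
  · have hκ := mem_shapes.mp hκ
    simp only [Finset.mem_product, Finset.mem_range] at hp
    exact tableauCount_mul_rowPairWeight hκ.antitone hκ.row_self hp.1 hp.2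
      (mem_shapes.mp h).antitone
  · have hκ := mem_shapes.mp hκ
    simp only [Finset.mem_product, Finset.mem_range] at hp
    exact mem_shapes.mpr
      (hκ.addPair hp.1 hp.2 (lt_of_rowPairWeight_one_ne_zero hκ.antitone hp.1 hp.2 h))

namespace YoungDiagram

theorem card_eq_sum_rowLen {N : ℕ} {μ : YoungDiagram} (h : μ.rowLen N = 0) :
    μ.card = ∑ i ∈ Finset.range N, μ.rowLen i := by
  have hmaps : ∀ c ∈ μ.cells, c.1 ∈ Finset.range N := by
    rintro ⟨i, j⟩ hc
    rw [Finset.mem_range]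
    by_contra! hi
    have h1 := mem_iff_lt_rowLen.mp ((mem_cells _).mp hc)
    have h2 : μ.rowLen i ≤ μ.rowLen N := μ.rowLen_anti _ _ hi
    omega
  rw [YoungDiagram.card, Finset.card_eq_sum_card_fiberwise hmaps]
  refine Finset.sum_congr rfl fun i _ => ?_
  rw [rowLen_eq_card]
  rfl

theorem antitone_rowLen (μ : YoungDiagram) : Antitone μ.rowLen := fun _ _ h => μ.rowLen_anti _ _ h

theorem rowLen_injective : Function.Injective rowLen := fun μ ν h => by
  refine YoungDiagram.ext (Finset.ext fun ⟨i, j⟩ => ?_)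
  rw [mem_cells, mem_cells, mem_iff_lt_rowLen, mem_iff_lt_rowLen, h]

theorem rowLen_le_card (μ : YoungDiagram) (i : ℕ) : μ.rowLen i ≤ μ.card := by
  rw [rowLen_eq_card]
  exact Finset.card_le_card (Finset.filter_subset _ _)

theorem exists_rowLen_eq {N : ℕ} {r : ℕ → ℕ} (hr : Antitone r) (hrN : r N = 0) :
    ∃ μ : YoungDiagram, μ.rowLen = r := by
  have hmem : ∀ i j, (i, j) ∈ ((Finset.range N ×ˢ Finset.range (r 0)).filter fun p => p.2 < r p.1)
      ↔ j < r i := by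
    intro i j
    simp only [Finset.mem_filter, Finset.mem_product, Finset.mem_range]
    refine ⟨fun h => h.2, fun h => ⟨⟨?_, h.trans_le (hr i.zero_le)⟩, h⟩⟩
    by_contra! hi
    have := hr hi
    omega
  refine ⟨⟨(Finset.range N ×ˢ Finset.range (r 0)).filter fun p => p.2 < r p.1, ?_⟩, ?_⟩
  · rintro ⟨i, j⟩ ⟨i', j'⟩ hle h
    rw [Finset.mem_coe, hmem] at h ⊢
    exact (hle.2.trans_lt h).trans_le (hr hle.1)
  · funext i
    refine eq_of_forall_lt_iff fun j => ?_
    rw [← mem_iff_lt_rowLen]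
    exact hmem i j

end YoungDiagram

open YoungDiagram

theorem numRows_le_iff (μ : YoungDiagram) (l : ℕ) : numRows μ ≤ l ↔ μ.rowLen l = 0 := by
  rw [numRows, ← not_lt, ← mem_iff_lt_colLen, mem_iff_lt_rowLen]
  omega

theorem oddCols_add_oddRowSum {N : ℕ} {μ : YoungDiagram} (h : μ.rowLen N = 0) :
    oddCols μ + oddRowSum N μ.rowLen = evenRowSum N μ.rowLen := by
  have hlt : ∀ i j, j < μ.rowLen i ↔ i < μ.colLen j := fun i j => by
    rw [← mem_iff_lt_rowLen, mem_iff_lt_colLen]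
  have key : ∀ a j, j ∈ Finset.Ico (μ.rowLen (2 * a + 1)) (μ.rowLen (2 * a)) ↔
      μ.colLen j = 2 * a + 1 := by
    intro a j
    have h1 := hlt (2 * a) j
    have h2 := hlt (2 * a + 1) j
    rw [Finset.mem_Ico]
    omega
  have e : ((Finset.range μ.card).filter fun j => Odd (μ.colLen j))
      = (Finset.range ((N + 1) / 2)).biUnion
        fun a => Finset.Ico (μ.rowLen (2 * a + 1)) (μ.rowLen (2 * a)) := by
    ext j
    simp only [Finset.mem_filter, Finset.mem_biUnion, Finset.mem_range, key]
    constructor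
    · rintro ⟨-, a, ha⟩
      refine ⟨a, ?_, ha⟩
      have h1 := (hlt (2 * a) j).mpr (by omega)
      have h2 : 2 * a < N := by
        by_contra! hc
        have := μ.antitone_rowLen hc
        omega
      omega
    · rintro ⟨a, -, ha⟩
      exact ⟨((hlt (2 * a) j).mpr (by omega)).trans_le (μ.rowLen_le_card _), a, ha⟩
  have hodd : oddRowSum N μ.rowLen
      = ∑ a ∈ Finset.range ((N + 1) / 2), μ.rowLen (2 * a + 1) := by
    unfold oddRowSum
    refine Finset.sum_subset (Finset.range_subset_range.mpr (by omega)) fun a ha ha' => ?_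
    rw [Finset.mem_range] at ha ha'
    rw [show 2 * a + 1 = N by omega, h]
  rw [oddCols, e, Finset.card_biUnion, hodd, evenRowSum, ← Finset.sum_add_distrib]
  · refine Finset.sum_congr rfl fun a _ => ?_
    rw [Nat.card_Ico]
    exact Nat.sub_add_cancel (μ.antitone_rowLen (Nat.le_succ _))
  · intro a _ b _ hab
    refine Finset.disjoint_left.mpr fun j h1 h2 => hab ?_
    rw [key] at h1 h2
    omega

theorem isShape_rowLen_iff {N : ℕ} {μ : YoungDiagram} (h : μ.rowLen N = 0) (l j m : ℕ) :
    IsShape N l j m μ.rowLen ↔ μ.card = 2 * j + m ∧ oddCols μ = m ∧ μ.rowLen l = 0 := by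
  have h1 := card_eq_sum_rowLen h
  have h2 := oddCols_add_oddRowSum h
  rw [sum_range_eq_sum_even_add_sum_odd] at h1
  change μ.card = evenRowSum N μ.rowLen + oddRowSum N μ.rowLen at h1
  constructor
  · intro hs
    have h3 := hs.evenRowSum_eq
    have h4 := hs.oddRowSum_eq
    exact ⟨by omega, by omega, hs.row_bound⟩
  · rintro ⟨h3, h4, h5⟩
    exact ⟨μ.antitone_rowLen, h, h5, by omega, by omega⟩

theorem SSYTN.isTableau {N : ℕ} {μ : YoungDiagram} (T : SSYTN N μ) :
    IsTableau N μ.rowLen T.1.entry where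
  row_weak hjk hk := T.1.row_weak' hjk (mem_iff_lt_rowLen.mpr hk)
  col_strict hik hj := T.1.col_strict' hik (mem_iff_lt_rowLen.mpr hj)
  mem_Icc hj := T.2 _ _ (mem_iff_lt_rowLen.mpr hj)
  zeros hj := T.1.zeros' fun h => hj.not_gt (mem_iff_lt_rowLen.mp h)

theorem IsTableau.exists_entry_eq {N : ℕ} {μ : YoungDiagram} {T : ℕ → ℕ → ℕ}
    (hT : IsTableau N μ.rowLen T) : ∃ T' : SSYTN N μ, T'.1.entry = T :=
  ⟨⟨⟨T, fun hjk hk => hT.row_weak hjk (mem_iff_lt_rowLen.mp hk),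
    fun hik hj => hT.col_strict hik (mem_iff_lt_rowLen.mp hj),
    fun h => hT.zeros (not_lt.mp fun h' => h (mem_iff_lt_rowLen.mpr h'))⟩,
    fun _ _ h => hT.mem_Icc (mem_iff_lt_rowLen.mp h)⟩, rfl⟩

theorem card_sigma_SSYTN (N l j m : ℕ) (P : YoungDiagram → Prop)
    (hP : ∀ μ : YoungDiagram, μ.rowLen N = 0 → (P μ ↔ IsShape N l j m μ.rowLen)) :
    (Nat.card (Σ μ : {μ : YoungDiagram // P μ}, SSYTN N μ.1) : ℝ)
      = ∑ r ∈ shapes N l j m, tableauCount N r := by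
  have hshape : ∀ p : Σ μ : {μ : YoungDiagram // P μ}, SSYTN N μ.1,
      p.1.1.rowLen ∈ shapes N l j m := fun p =>
    mem_shapes.mpr ((hP _ (p.2.isTableau.row_eq_zero p.1.1.antitone_rowLen)).mp p.1.2)
  let f : (Σ μ : {μ : YoungDiagram // P μ}, SSYTN N μ.1) →
      Σ r : shapes N l j m, {T // IsTableau N r.1 T} :=
    fun p => ⟨⟨p.1.1.rowLen, hshape p⟩, ⟨p.2.1.entry, p.2.isTableau⟩⟩
  have hf : Function.Bijective f := by
    constructor
    · rintro ⟨⟨μ, hμ⟩, T⟩ ⟨⟨ν, hν⟩, T'⟩ h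
      have h1 : μ = ν := rowLen_injective (congrArg (fun p => p.1.1) h)
      have h2 : T.1.entry = T'.1.entry := congrArg (fun p => p.2.1) h
      subst h1
      obtain rfl : T = T' := Subtype.ext (DFunLike.ext' h2)
      rfl
    · rintro ⟨⟨r, hr⟩, T, hT⟩
      have hs := mem_shapes.mp hr
      obtain ⟨μ, rfl⟩ := exists_rowLen_eq hs.antitone hs.row_self
      obtain ⟨T', rfl⟩ := hT.exists_entry_eq
      exact ⟨⟨⟨μ, (hP μ hs.row_self).mpr hs⟩, T'⟩, rfl⟩
  have := fun r : shapes N l j m => finite_isTableau N r.1 (mem_shapes.mp r.2).antitone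
  rw [Nat.card_congr (Equiv.ofBijective f hf), Nat.card_sigma, Nat.cast_sum]
  exact Finset.sum_coe_sort (shapes N l j m) fun r => tableauCount N r

theorem bL_eq_sum (N j m l : ℕ) : (bL N j m l : ℝ) = ∑ r ∈ shapes N l j m, tableauCount N r :=
  card_sigma_SSYTN N l j m _ fun μ h => by rw [isShape_rowLen_iff h, numRows_le_iff]

theorem bInf_eq_sum (N j m : ℕ) : (bInf N j m : ℝ) = ∑ r ∈ shapes N N j m, tableauCount N r :=
  card_sigma_SSYTN N N j m _ fun μ h => by rw [isShape_rowLen_iff h, and_iff_left h]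

theorem div_le_div_of_mul_le_of_mul_eq {b b' c c' p q : ℝ} (hp : 0 < p) (hb : 0 ≤ b) (hc : 0 ≤ c)
    (hc' : 0 ≤ c') (h1 : p * b' ≤ q * b) (h2 : p * c' = q * c) : b' / c' ≤ b / c := by
  rcases hc'.eq_or_lt with rfl | hc'
  · rw [div_zero]
    positivity
  · have hc0 : 0 < c := by
      refine lt_of_le_of_ne hc fun h => ?_
      rw [← h, mul_zero] at h2
      exact (mul_pos hp hc').ne' h2
    rw [div_le_div_iff₀ hc' hc0]
    refine le_of_mul_le_mul_left ?_ hp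
    calc p * (b' * c) = p * b' * c := by ring
      _ ≤ q * b * c := mul_le_mul_of_nonneg_right h1 hc
      _ = b * (q * c) := by ring
      _ = p * (b * c') := by rw [← h2]; ring

/-- Monotonicity: `p(N,j+1,m,l) ≤ p(N,j,m,l)` and `p(N,j,m+1,l) ≤ p(N,j,m,l)`. -/
theorem pRatio_monotone (N : ℕ) (hN : 0 < N) (j m l : ℕ) (hl : 0 < l) :
    pRatio N (j + 1) m l ≤ pRatio N j m l ∧ pRatio N j (m + 1) l ≤ pRatio N j m l := by
  have hnonneg : ∀ k, 0 ≤ ∑ r ∈ shapes N k j m, tableauCount N r := fun k =>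
    Finset.sum_nonneg fun r _ => tableauCount_nonneg N r
  have hnonneg' : ∀ j m, 0 ≤ ∑ r ∈ shapes N N j m, tableauCount N r := fun j m =>
    Finset.sum_nonneg fun r _ => tableauCount_nonneg N r
  simp only [pRatio, bL_eq_sum, bInf_eq_sum]
  exact ⟨div_le_div_of_mul_le_of_mul_eq (by positivity) (hnonneg l) (hnonneg N) (hnonneg' _ _)
      (pair_sum_le N l j m) (pair_sum_eq N j m),
    div_le_div_of_mul_le_of_mul_eq (by positivity) (hnonneg l) (hnonneg N) (hnonneg' _ _)
      (row_sum_le N l j m) (row_sum_eq N j m)⟩
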